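/- Let (X,d,m) be a metric measure space, fix x ∈ X and a Borel set E ⊆ X, let d_x := d(·,x), and define f(r) := |D d_x|(E ∩ B_r(x)) for r > 0. Then f(r) = ∫_0^r P(B_s(x), E) ds for every r > 0; consequently f is locally absolutely continuous on (0,∞) and f'(r) = P(B_r(x), E) for Lebesgue-a.e. r > 0. -/

import Mathlib

open MeasureTheory Metric Set Filter Topology ENNReal Bornology
open scoped symmDiff

noncomputable section

variable {X : Type*}

/-- The slope (pointwise Lipschitz constant) of `f` at `x`, computed within `Ω`.
It vanishes at points that are isolated in `Ω`. -/
def slopeOn [MetricSpace X] (Ω : Set X) (f : X → ℝ) (x : X) : ℝ≥0∞ :=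
  Filter.limsup (fun y => ENNReal.ofReal (|f x - f y| / dist x y)) (𝓝[Ω \ {x}] x)

/-- The slope of `f`. -/
def mSlope [MetricSpace X] (f : X → ℝ) (x : X) : ℝ≥0∞ := slopeOn Set.univ f x

/-- `f` is locally Lipschitz on `Ω`. -/
def LocLipOn [MetricSpace X] (Ω : Set X) (f : X → ℝ) : Prop :=
  ∀ x ∈ Ω, ∃ r > (0:ℝ), ∃ K : NNReal, LipschitzOnWith K f (Metric.ball x r ∩ Ω)

/-- Convergence `fn → f` in `L¹_loc(Ω)` w.r.t. the measure `m`. -/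
def TendstoL1loc [MetricSpace X] [MeasurableSpace X] (m : Measure X) (Ω : Set X)
    (fn : ℕ → X → ℝ) (f : X → ℝ) : Prop :=
  ∀ K : Set X, K ⊆ Ω → IsCompact K →
    Tendsto (fun n => ∫⁻ x in K, ENNReal.ofReal |fn n x - f x| ∂m) atTop (𝓝 0)

/-- The total variation `|Df|(B)` of `f : X → ℝ` on the set `B`. -/
def totVar [MetricSpace X] [MeasurableSpace X] (m : Measure X) (f : X → ℝ) (B : Set X) : ℝ≥0∞ :=
  ⨅ (Ω : Set X) (_ : IsOpen Ω) (_ : B ⊆ Ω),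
    ⨅ (fn : ℕ → X → ℝ) (_ : ∀ n, LocLipOn Ω (fn n)) (_ : TendstoL1loc m Ω fn f),
      Filter.liminf (fun n => ∫⁻ x in Ω, slopeOn Ω (fn n) x ∂m) atTop

/-- The perimeter `P(E, B)` of a set `E` in `B`. -/
def Per [MetricSpace X] [MeasurableSpace X] (m : Measure X) (E B : Set X) : ℝ≥0∞ :=
  totVar m (Set.indicator E fun _ => (1:ℝ)) B

/-- `E` has locally finite perimeter. -/
def HasLocFinPer [MetricSpace X] [MeasurableSpace X] (m : Measure X) (E : Set X) : Prop :=
  ∀ x : X, ∃ r > (0:ℝ), Per m E (Metric.ball x r) < ∞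

/-- `E` has finite perimeter. -/
def HasFinPer [MetricSpace X] [MeasurableSpace X] (m : Measure X) (E : Set X) : Prop :=
  Per m E Set.univ < ∞

/-- `m` is finite on bounded sets. -/
def BoundedlyFinite [MetricSpace X] [MeasurableSpace X] (m : Measure X) : Prop :=
  ∀ B : Set X, Bornology.IsBounded B → m B < ∞

/-- Uniformly locally doubling with doubling function `C_D`. -/
def UnifLocDoublingWith [MetricSpace X] [MeasurableSpace X] (C_D : ℝ → ℝ) (m : Measure X) : Prop :=
  ∀ R : ℝ, 0 < R → ∀ x : X, ∀ r : ℝ, 0 < r → r < R →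
    m (Metric.ball x (2 * r)) ≤ ENNReal.ofReal (C_D R) * m (Metric.ball x r)

/-- Weak local (1,1)-Poincaré inequality with dilation `lam` and constant function `C_P`. -/
def WeakPoincareWith [MetricSpace X] [MeasurableSpace X] (lam : ℝ) (C_P : ℝ → ℝ)
    (m : Measure X) : Prop :=
  ∀ f : X → ℝ, LocLipOn Set.univ f → ∀ R : ℝ, 0 < R → ∀ x : X, ∀ r : ℝ, 0 < r → r < R →
    (∫⁻ y in Metric.ball x r,
        ENNReal.ofReal |f y - ⨍ z in Metric.ball x r, f z ∂m| ∂m) / m (Metric.ball x r)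
      ≤ ENNReal.ofReal (C_P R * r) *
          ((∫⁻ y in Metric.ball x (lam * r), mSlope f y ∂m) / m (Metric.ball x (lam * r)))

/-- `(X, d, m)` is a PI space. -/
def IsPIspace [MetricSpace X] [MeasurableSpace X] (m : Measure X) : Prop :=
  (∃ C_D : ℝ → ℝ, (∀ R, 0 < R → 0 < C_D R) ∧ UnifLocDoublingWith C_D m) ∧
  (∃ lam : ℝ, 1 ≤ lam ∧ ∃ C_P : ℝ → ℝ, (∀ R, 0 < R → 0 < C_P R) ∧ WeakPoincareWith lam C_P m)

/-- `(X, d)` is a length space: the distance between two points is the infimum of the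
lengths of continuous curves joining them. -/
def IsLengthSpace (X : Type*) [MetricSpace X] : Prop :=
  ∀ p q : X, ENNReal.ofReal (dist p q) =
    ⨅ (γ : ℝ → X) (_ : ContinuousOn γ (Set.Icc 0 1)) (_ : γ 0 = p) (_ : γ 1 = q),
      eVariationOn γ (Set.Icc 0 1)

/-- Essential interior `E^{(1)}`. -/
def essInt [MetricSpace X] [MeasurableSpace X] (m : Measure X) (E : Set X) : Set X :=
  { x | Tendsto (fun r : ℝ => m (E ∩ Metric.ball x r) / m (Metric.ball x r)) (𝓝[>] 0) (𝓝 1) }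

/-- Essential exterior `E^{(0)}`. -/
def essExt [MetricSpace X] [MeasurableSpace X] (m : Measure X) (E : Set X) : Set X :=
  { x | Tendsto (fun r : ℝ => m (E ∩ Metric.ball x r) / m (Metric.ball x r)) (𝓝[>] 0) (𝓝 0) }

/-- Essential boundary `∂^e E`. -/
def essBdry [MetricSpace X] [MeasurableSpace X] (m : Measure X) (E : Set X) : Set X :=
  (essInt m E ∪ essExt m E)ᶜ

/-- The two deformation inequalities hold for `E` at `x` with radius `R` and constant `C`. -/
def DeformIneq [MetricSpace X] [MeasurableSpace X] (m : Measure X) (E : Set X) (x : X)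
    (R C : ℝ) : Prop :=
  ∀ y ∈ Metric.ball x R, ∀ r ∈ Set.Ioo (0:ℝ) R,
    Per m (E \ Metric.ball y r) (Metric.ball x (2 * R)) ≤
      ENNReal.ofReal C * m (Metric.ball y r ∩ E) / ENNReal.ofReal r +
        Per m E (Metric.ball x (2 * R)) ∧
    Per m (E ∪ Metric.ball y r) (Metric.ball x (2 * R)) ≤
      ENNReal.ofReal C * m (Metric.ball y r \ E) / ENNReal.ofReal r +
        Per m E (Metric.ball x (2 * R))

/-- The deformation inequalities hold for `E` at `x` with radius `R` and some constant. -/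
def DeformAt [MetricSpace X] [MeasurableSpace X] (m : Measure X) (E : Set X) (x : X)
    (R : ℝ) : Prop :=
  0 < R ∧ R ≤ 1 ∧ ∃ C : ℝ, 0 ≤ C ∧ DeformIneq m E x R C

/-- `R_x(E)`: the maximal radius in `(0,1]` for which the deformation inequalities hold. -/
def deformRadius [MetricSpace X] [MeasurableSpace X] (m : Measure X) (E : Set X) (x : X) : ℝ :=
  sSup { R : ℝ | DeformAt m E x R }

/-- `(X, d, m)` has the deformation property. -/
def DeformationProperty [MetricSpace X] [MeasurableSpace X] (m : Measure X) : Prop :=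
  ∀ E : Set X, MeasurableSet E → HasLocFinPer m E → ∀ x : X, ∃ R : ℝ, DeformAt m E x R

/-- `E` is a volume-constrained minimizer of the perimeter. -/
def VolConstMin [MetricSpace X] [MeasurableSpace X] (m : Measure X) (E : Set X) : Prop :=
  MeasurableSet E ∧ HasLocFinPer m E ∧
    ∀ F K : Set X, MeasurableSet F → IsCompact K →
      m ((E ∆ F) \ K) = 0 → m (E ∩ K) = m (F ∩ K) → Per m E K ≤ Per m F K

/-- `E` is an isoperimetric set. -/
def IsIsoperimetricSet [MetricSpace X] [MeasurableSpace X] (m : Measure X) (E : Set X) : Prop :=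
  MeasurableSet E ∧ HasFinPer m E ∧ 0 < m E ∧ m E < ∞ ∧
    ∀ F : Set X, MeasurableSet F → m F = m E → Per m E Set.univ ≤ Per m F Set.univ


/-- Absolute continuity of `g` on the interval `[a, b]`. -/
def AbsContOnI (g : ℝ → ℝ) (a b : ℝ) : Prop :=
  ∀ ε > (0:ℝ), ∃ δ > (0:ℝ), ∀ n : ℕ, ∀ s t : Fin n → ℝ,
    (∀ i, s i ∈ Set.Icc a b ∧ t i ∈ Set.Icc a b ∧ s i ≤ t i) →
    (Pairwise fun i j => Disjoint (Set.Ioo (s i) (t i)) (Set.Ioo (s j) (t j))) →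
    (∑ i, (t i - s i)) < δ → (∑ i, |g (t i) - g (s i)|) < ε

section Slope

variable [MetricSpace X]

/-- `f` is Lipschitz on some neighbourhood of `x`. -/
def LipNear (f : X → ℝ) (x : X) : Prop :=
  ∃ K : NNReal, ∃ t ∈ 𝓝 x, LipschitzOnWith K f t

lemma locLipOn_iff {Ω : Set X} (hΩ : IsOpen Ω) {f : X → ℝ} :
    LocLipOn Ω f ↔ ∀ x ∈ Ω, LipNear f x := by
  constructor
  · intro h x hx
    obtain ⟨r, hr, K, hK⟩ := h x hx
    exact ⟨K, _, inter_mem (ball_mem_nhds x hr) (hΩ.mem_nhds hx), hK⟩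
  · intro h x hx
    obtain ⟨K, t, ht, hK⟩ := h x hx
    obtain ⟨r, hr, hrt⟩ := Metric.mem_nhds_iff.1 ht
    exact ⟨r, hr, K, hK.mono (inter_subset_left.trans hrt)⟩

lemma LocLipOn.mono {Ω Ω' : Set X} {f : X → ℝ} (h : LocLipOn Ω f) (hs : Ω' ⊆ Ω) :
    LocLipOn Ω' f := by
  intro x hx
  obtain ⟨r, hr, K, hK⟩ := h x (hs hx)
  exact ⟨r, hr, K, hK.mono (inter_subset_inter_right _ hs)⟩

lemma LipschitzWith.lipNear {K : NNReal} {f : X → ℝ} (h : LipschitzWith K f) (x : X) :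
    LipNear f x := ⟨K, univ, univ_mem, h.lipschitzOnWith⟩

lemma LipNear.congr {f g : X → ℝ} {x : X} (h : LipNear f x) (hfg : f =ᶠ[𝓝 x] g) :
    LipNear g x := by
  obtain ⟨K, t, ht, hK⟩ := h
  refine ⟨K, t ∩ {y | f y = g y}, inter_mem ht hfg, fun y hy z hz => ?_⟩
  rw [← show f y = g y from hy.2, ← show f z = g z from hz.2]
  exact hK hy.1 hz.1

lemma LipNear.comp {f : X → ℝ} {x : X} (h : LipNear f x) {φ : ℝ → ℝ} {K : NNReal}
    (hφ : LipschitzWith K φ) : LipNear (fun y => φ (f y)) x := by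
  obtain ⟨K', t, ht, hK⟩ := h
  exact ⟨K * K', t, ht, hφ.comp_lipschitzOnWith hK⟩

lemma LipNear.add {f g : X → ℝ} {x : X} (hf : LipNear f x) (hg : LipNear g x) :
    LipNear (fun y => f y + g y) x := by
  obtain ⟨K, t, ht, hK⟩ := hf
  obtain ⟨K', t', ht', hK'⟩ := hg
  exact ⟨K + K', t ∩ t', inter_mem ht ht',
    (hK.mono inter_subset_left).add (hK'.mono inter_subset_right)⟩

lemma LipNear.continuousAt {f : X → ℝ} {x : X} (hf : LipNear f x) : ContinuousAt f x := by
  obtain ⟨K, t, ht, hK⟩ := hf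
  exact hK.continuousOn.continuousAt ht

lemma LipNear.mul {f g : X → ℝ} {x : X} (hf : LipNear f x) (hg : LipNear g x) :
    LipNear (fun y => f y * g y) x := by
  have bf : ∀ᶠ y in 𝓝 x, |f y| < |f x| + 1 :=
    hf.continuousAt.abs.eventually_lt continuousAt_const (by simp)
  have bg : ∀ᶠ y in 𝓝 x, |g y| < |g x| + 1 :=
    hg.continuousAt.abs.eventually_lt continuousAt_const (by simp)
  obtain ⟨K, t, ht, hK⟩ := hf
  obtain ⟨K', t', ht', hK'⟩ := hg
  refine ⟨Real.toNNReal (K * (|g x| + 1) + K' * (|f x| + 1)), t ∩ t' ∩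
    ({y | |f y| < |f x| + 1} ∩ {y | |g y| < |g x| + 1}),
    inter_mem (inter_mem ht ht') (inter_mem bf bg), ?_⟩
  apply LipschitzOnWith.of_dist_le_mul
  rintro y ⟨⟨hy, hy'⟩, hfy, hgy⟩ z ⟨⟨hz, hz'⟩, hfz, hgz⟩
  have h1 := hK.dist_le_mul y hy z hz
  have h2 := hK'.dist_le_mul y hy' z hz'
  simp only [mem_ofPred_eq] at hfy hgy hfz hgz
  rw [Real.coe_toNNReal _ (by positivity)]
  rw [Real.dist_eq] at h1 h2 ⊢
  have e : f y * g y - f z * g z = (f y - f z) * g y + (g y - g z) * f z := by ring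
  rw [e]
  calc |(f y - f z) * g y + (g y - g z) * f z|
      ≤ |f y - f z| * |g y| + |g y - g z| * |f z| := by
        rw [← abs_mul, ← abs_mul]; exact abs_add_le _ _
    _ ≤ (K * dist y z) * (|g x| + 1) + (K' * dist y z) * (|f x| + 1) := by gcongr
    _ = _ := by ring

lemma LipNear.sum {ι : Type*} {f : ι → X → ℝ} {x : X} (s : Finset ι)
    (h : ∀ i ∈ s, LipNear (f i) x) : LipNear (fun y => ∑ i ∈ s, f i y) x := by
  classical
  induction s using Finset.induction_on with
  | empty => simpa using (LipschitzWith.const (0 : ℝ)).lipNear x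
  | insert a s ha ih =>
    simp only [Finset.sum_insert ha]
    exact (h a (by simp)).add (ih fun i hi => h i (by simp [hi]))

lemma slopeOn_eq_mSlope {Ω : Set X} (hΩ : IsOpen Ω) (f : X → ℝ) {x : X} (hx : x ∈ Ω) :
    slopeOn Ω f x = mSlope f x := by
  have h : 𝓝[Ω \ {x}] x = 𝓝[univ \ {x}] x := by
    rw [sdiff_eq, sdiff_eq, univ_inter, inter_comm, nhdsWithin_inter_of_mem' _]
    exact mem_nhdsWithin_of_mem_nhds (hΩ.mem_nhds hx)
  simp [mSlope, slopeOn, h]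

lemma mSlope_congr {f g : X → ℝ} {x : X} (h : f =ᶠ[𝓝 x] g) : mSlope f x = mSlope g x := by
  unfold mSlope slopeOn
  apply limsup_congr
  filter_upwards [nhdsWithin_le_nhds h] with y hy
  rw [hy, h.self_of_nhds]

lemma mSlope_le_of_eventually {f : X → ℝ} {x : X} {c : ℝ≥0∞}
    (h : ∀ᶠ y in 𝓝 x, ENNReal.ofReal (|f x - f y| / dist x y) ≤ c) : mSlope f x ≤ c :=
  limsup_le_of_le (by isBoundedDefault) (nhdsWithin_le_nhds h)

lemma eventually_of_mSlope_lt {f : X → ℝ} {x : X} {c : ℝ≥0∞} (h : mSlope f x < c) :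
    ∀ᶠ y in 𝓝 x, ENNReal.ofReal (|f x - f y| / dist x y) < c := by
  have := eventually_lt_of_limsup_lt h
  rw [eventually_nhdsWithin_iff] at this
  filter_upwards [this] with y hy
  by_cases hyx : y = x
  · subst hyx
    simpa using bot_lt_of_lt h
  · exact hy ⟨mem_univ _, hyx⟩

lemma mSlope_const (c : ℝ) (x : X) : mSlope (fun _ : X => c) x = 0 :=
  le_antisymm (mSlope_le_of_eventually (by simp)) bot_le

lemma mSlope_le_of_lipschitz {f : X → ℝ} {K : NNReal} (h : LipschitzWith K f) (x : X) :
    mSlope f x ≤ K := by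
  refine mSlope_le_of_eventually (Eventually.of_forall fun y => ?_)
  refine ENNReal.ofReal_le_of_le_toReal ?_
  have := h.dist_le_mul x y
  rw [Real.dist_eq] at this
  exact div_le_of_le_mul₀ dist_nonneg (by simp) (by simpa using this)

lemma mSlope_comp_le (f : X → ℝ) {φ : ℝ → ℝ} {K : NNReal} (hφ : LipschitzWith K φ) (x : X) :
    mSlope (fun y => φ (f y)) x ≤ K * mSlope f x := by
  unfold mSlope slopeOn
  rw [← ENNReal.limsup_const_mul_of_ne_top ENNReal.coe_ne_top]
  apply limsup_le_limsup _ (by isBoundedDefault) (by isBoundedDefault)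
  refine Eventually.of_forall fun y => ?_
  have := hφ.dist_le_mul (f x) (f y)
  rw [Real.dist_eq, Real.dist_eq] at this
  beta_reduce
  rw [← ENNReal.ofReal_coe_nnreal, ← ENNReal.ofReal_mul (by simp)]
  apply ENNReal.ofReal_le_ofReal
  rw [← mul_div_assoc]
  gcongr

lemma mSlope_add_le (f g : X → ℝ) (x : X) :
    mSlope (fun y => f y + g y) x ≤ mSlope f x + mSlope g x := by
  refine ENNReal.le_of_forall_pos_le_add fun ε hε hlt => ?_
  have h1 : mSlope f x < mSlope f x + (ε / 2 : NNReal) :=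
    ENNReal.lt_add_right (ne_top_of_lt (lt_of_le_of_lt le_self_add hlt)) (by simpa using hε.ne')
  have h2 : mSlope g x < mSlope g x + (ε / 2 : NNReal) :=
    ENNReal.lt_add_right (ne_top_of_lt (lt_of_le_of_lt le_add_self hlt)) (by simpa using hε.ne')
  refine mSlope_le_of_eventually ?_
  filter_upwards [eventually_of_mSlope_lt h1, eventually_of_mSlope_lt h2] with y hy1 hy2
  calc ENNReal.ofReal (|f x + g x - (f y + g y)| / dist x y)
      ≤ ENNReal.ofReal (|f x - f y| / dist x y + |g x - g y| / dist x y) := by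
        apply ENNReal.ofReal_le_ofReal
        rw [← add_div]
        gcongr
        rw [show f x + g x - (f y + g y) = (f x - f y) + (g x - g y) by ring]
        exact abs_add_le _ _
    _ ≤ _ := ENNReal.ofReal_add_le
    _ ≤ (mSlope f x + (ε / 2 : NNReal)) + (mSlope g x + (ε / 2 : NNReal)) := by gcongr
    _ = mSlope f x + mSlope g x + ((ε / 2 : NNReal) + (ε / 2 : NNReal)) := by ring
    _ = _ := by rw [← ENNReal.coe_add, add_halves]

lemma measurable_indicator_mSlope [MeasurableSpace X] [BorelSpace X] {Ω : Set X}
    (hΩ : IsOpen Ω) {g : X → ℝ} (hg : ContinuousOn g Ω) :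
    Measurable (Ω.indicator (mSlope g)) := by
  let h : ℕ → X → ℝ≥0∞ := fun n x => ⨆ y ∈ ball x (1 / ((n : ℝ) + 1)) ∩ (Ω \ {x}),
    ENNReal.ofReal (|g x - g y| / dist x y)
  have key : Ω.indicator (mSlope g) = fun x => ⨅ n, Ω.indicator (h n) x := by
    funext x
    by_cases hx : x ∈ Ω
    · simp only [indicator_of_mem hx]
      rw [← slopeOn_eq_mSlope hΩ g hx, slopeOn,
        (nhdsWithin_hasBasis nhds_basis_ball_inv_nat_succ _).limsup_eq_iInf_iSup]
      simp [h]
    · simp [indicator_of_notMem hx]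
  rw [key]
  refine Measurable.iInf fun n => measurable_of_Ioi fun c => ?_
  have : Ω.indicator (h n) ⁻¹' Ioi c = ⋃ y ∈ Ω, ((Ω ∩ ({y}ᶜ ∩ ball y (1 / ((n : ℝ) + 1)))) ∩
      (fun x => ENNReal.ofReal (|g x - g y| / dist x y)) ⁻¹' Ioi c) := by
    ext x
    by_cases hx : x ∈ Ω
    · simp only [mem_preimage, indicator_of_mem hx, mem_Ioi, h, lt_iSup_iff, mem_iUnion, mem_inter_iff,
        mem_ball, Set.mem_sdiff, mem_singleton_iff, mem_compl_iff, hx, true_and]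
      constructor
      · rintro ⟨y, ⟨h1, h2, h3⟩, h4⟩
        exact ⟨y, h2, ⟨fun h => h3 h.symm, by rwa [dist_comm]⟩, h4⟩
      · rintro ⟨y, h2, ⟨h3, h1⟩, h4⟩
        exact ⟨y, ⟨by rwa [dist_comm], h2, fun h => h3 h.symm⟩, h4⟩
    · simp [hx]
  rw [this]
  refine (isOpen_biUnion fun y hy => ?_).measurableSet
  refine ContinuousOn.isOpen_inter_preimage ?_
    (hΩ.inter (isOpen_compl_singleton.inter isOpen_ball)) isOpen_Ioi
  refine ENNReal.continuous_ofReal.comp_continuousOn ?_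
  refine ContinuousOn.div (((hg.mono inter_subset_left).sub continuousOn_const).abs)
    (by fun_prop) ?_
  rintro x ⟨-, hxy, -⟩
  exact dist_ne_zero.2 hxy

lemma LocLipOn.continuousOn {Ω : Set X} (hΩ : IsOpen Ω) {g : X → ℝ} (hg : LocLipOn Ω g) :
    ContinuousOn g Ω := fun x hx =>
  ((locLipOn_iff hΩ).1 hg x hx).continuousAt.continuousWithinAt

lemma LocLipOn.comp {Ω : Set X} (hΩ : IsOpen Ω) {g : X → ℝ} (hg : LocLipOn Ω g) {φ : ℝ → ℝ}
    {K : NNReal} (hφ : LipschitzWith K φ) : LocLipOn Ω fun y => φ (g y) :=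
  (locLipOn_iff hΩ).2 fun x hx => ((locLipOn_iff hΩ).1 hg x hx).comp hφ

lemma LocLipOn.add {Ω : Set X} (hΩ : IsOpen Ω) {f g : X → ℝ} (hf : LocLipOn Ω f)
    (hg : LocLipOn Ω g) : LocLipOn Ω fun y => f y + g y :=
  (locLipOn_iff hΩ).2 fun x hx =>
    ((locLipOn_iff hΩ).1 hf x hx).add ((locLipOn_iff hΩ).1 hg x hx)

end Slope

section Approximation

variable [MetricSpace X] [MeasurableSpace X] {m : Measure X}

lemma totVar_mono (m : Measure X) (f : X → ℝ) {A B : Set X} (h : A ⊆ B) :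
    totVar m f A ≤ totVar m f B :=
  le_iInf fun Ω => le_iInf fun hΩ => le_iInf fun hB =>
    iInf_le_of_le Ω (iInf_le_of_le hΩ (iInf_le_of_le (h.trans hB) le_rfl))

lemma setLIntegral_slopeOn [BorelSpace X] {Ω : Set X} (hΩ : IsOpen Ω) (m : Measure X) (g : X → ℝ) :
    ∫⁻ x in Ω, slopeOn Ω g x ∂m = ∫⁻ x in Ω, mSlope g x ∂m :=
  setLIntegral_congr_fun hΩ.measurableSet fun _ hx => slopeOn_eq_mSlope hΩ g hx

lemma totVar_le_liminf [BorelSpace X] {f : X → ℝ} {Ω B : Set X} (hΩ : IsOpen Ω) (hB : B ⊆ Ω)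
    {fn : ℕ → X → ℝ} (hfn : ∀ n, LocLipOn Ω (fn n)) (hlim : TendstoL1loc m Ω fn f) :
    totVar m f B ≤ liminf (fun n => ∫⁻ x in Ω, mSlope (fn n) x ∂m) atTop := by
  simp only [← setLIntegral_slopeOn hΩ]
  exact iInf_le_of_le Ω (iInf_le_of_le hΩ (iInf_le_of_le hB
    (iInf_le_of_le fn (iInf_le_of_le hfn (iInf_le_of_le hlim le_rfl)))))

lemma exists_seq_of_totVar_lt [BorelSpace X] {f : X → ℝ} {B : Set X} {c : ℝ≥0∞}
    (h : totVar m f B < c) :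
    ∃ Ω, IsOpen Ω ∧ B ⊆ Ω ∧ ∃ fn : ℕ → X → ℝ, (∀ n, LocLipOn Ω (fn n)) ∧
      TendstoL1loc m Ω fn f ∧ liminf (fun n => ∫⁻ x in Ω, mSlope (fn n) x ∂m) atTop < c := by
  simp only [totVar, iInf_lt_iff] at h
  obtain ⟨Ω, hΩ, hB, fn, hfn, hlim, hc⟩ := h
  simp only [setLIntegral_slopeOn hΩ] at hc
  exact ⟨Ω, hΩ, hB, fn, hfn, hlim, hc⟩

lemma TendstoL1loc.mono {Ω Ω' : Set X} {fn : ℕ → X → ℝ} {f : X → ℝ}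
    (h : TendstoL1loc m Ω fn f) (hs : Ω' ⊆ Ω) : TendstoL1loc m Ω' fn f :=
  fun K hK hc => h K (hK.trans hs) hc

lemma exists_seq_of_totVar_open_lt [BorelSpace X] {f : X → ℝ} {U : Set X}
    {c : ℝ≥0∞} (h : totVar m f U < c) :
    ∃ fn : ℕ → X → ℝ, (∀ n, LocLipOn U (fn n)) ∧
      TendstoL1loc m U fn f ∧ liminf (fun n => ∫⁻ x in U, mSlope (fn n) x ∂m) atTop < c := by
  obtain ⟨Ω, hΩ, hB, fn, hfn, hlim, hc⟩ := exists_seq_of_totVar_lt h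
  refine ⟨fn, fun n => (hfn n).mono hB, hlim.mono hB, lt_of_le_of_lt ?_ hc⟩
  exact liminf_le_liminf (Eventually.of_forall fun n => lintegral_mono_set hB)

lemma exists_open_totVar_lt [BorelSpace X] {f : X → ℝ} {B : Set X} {c : ℝ≥0∞}
    (h : totVar m f B < c) : ∃ Ω, IsOpen Ω ∧ B ⊆ Ω ∧ totVar m f Ω < c := by
  obtain ⟨Ω, hΩ, hB, fn, hfn, hlim, hc⟩ := exists_seq_of_totVar_lt h
  exact ⟨Ω, hΩ, hB, (totVar_le_liminf hΩ Subset.rfl hfn hlim).trans_lt hc⟩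

/-- `f` is a limit in `L¹(U)` of locally Lipschitz functions whose total variations on `U` are
asymptotically bounded by `c`. -/
def Appr (m : Measure X) (f : X → ℝ) (U : Set X) (c : ℝ≥0∞) : Prop :=
  ∀ ε : ℝ≥0∞, ε ≠ 0 → ∃ g : X → ℝ, LocLipOn U g ∧
    ∫⁻ x in U, ENNReal.ofReal |g x - f x| ∂m ≤ ε ∧ ∫⁻ x in U, mSlope g x ∂m ≤ c + ε

lemma Appr.mono {f : X → ℝ} {U : Set X} {c c' : ℝ≥0∞} (h : Appr m f U c) (hc : c ≤ c') :
    Appr m f U c' := fun ε hε => by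
  obtain ⟨g, h1, h2, h3⟩ := h ε hε
  exact ⟨g, h1, h2, h3.trans (by gcongr)⟩

lemma LocLipOn.appr {f : X → ℝ} {U : Set X} (h : LocLipOn U f) :
    Appr m f U (∫⁻ x in U, mSlope f x ∂m) :=
  fun ε _ => ⟨f, h, by simp, le_self_add⟩

lemma Appr.congr_on [BorelSpace X] {f f' : X → ℝ} {U : Set X} (hU : IsOpen U) {c : ℝ≥0∞}
    (h : Appr m f U c) (hf : EqOn f f' U) : Appr m f' U c := fun ε hε => by
  obtain ⟨g, h1, h2, h3⟩ := h ε hε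
  refine ⟨g, h1, ?_, h3⟩
  rwa [setLIntegral_congr_fun hU.measurableSet fun x hx => by rw [← hf hx]]

lemma Appr.totVar_le [BorelSpace X] {f : X → ℝ} {U : Set X} {c : ℝ≥0∞} (hU : IsOpen U)
    (h : Appr m f U c) : totVar m f U ≤ c := by
  have hpos : ∀ n : ℕ, ((n : ℝ≥0∞))⁻¹ ≠ 0 := fun n => by simp
  choose g h1 h2 h3 using fun n : ℕ => h _ (hpos n)
  have hlim : TendstoL1loc m U g f := fun K hK _ =>
    tendsto_of_tendsto_of_tendsto_of_le_of_le tendsto_const_nhds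
      ENNReal.tendsto_inv_nat_nhds_zero (fun _ => bot_le)
      fun n => (lintegral_mono_set hK).trans (h2 n)
  refine (totVar_le_liminf hU Subset.rfl h1 hlim).trans ?_
  refine (liminf_le_liminf (Eventually.of_forall h3)).trans ?_
  have : Tendsto (fun n : ℕ => c + ((n : ℝ≥0∞))⁻¹) atTop (𝓝 (c + 0)) :=
    tendsto_const_nhds.add ENNReal.tendsto_inv_nat_nhds_zero
  rw [this.liminf_eq, add_zero]

lemma aemeasurable_mSlope [BorelSpace X] {U : Set X} (hU : IsOpen U) {g : X → ℝ}
    (hg : LocLipOn U g) : AEMeasurable (mSlope g) (m.restrict U) :=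
  (aemeasurable_indicator_iff hU.measurableSet).1
    (measurable_indicator_mSlope hU (hg.continuousOn hU)).aemeasurable

lemma aemeasurable_abs_sub [BorelSpace X] {U : Set X} (hU : IsOpen U) {g f : X → ℝ}
    (hg : LocLipOn U g) (hf : Measurable f) :
    AEMeasurable (fun x => ENNReal.ofReal |g x - f x|) (m.restrict U) := by
  have := (hg.continuousOn hU).aemeasurable (μ := m) hU.measurableSet
  exact (continuous_abs.measurable.comp_aemeasurable (this.sub hf.aemeasurable)).ennreal_ofReal

lemma ofReal_abs_sub_le (a b c : ℝ) :
    ENNReal.ofReal |a - c| ≤ ENNReal.ofReal |a - b| + ENNReal.ofReal |b - c| := by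
  rw [← ENNReal.ofReal_add (abs_nonneg _) (abs_nonneg _)]
  exact ENNReal.ofReal_le_ofReal (abs_sub_le _ _ _)

lemma Appr.of_close [BorelSpace X] {f : X → ℝ} {U : Set X} {c : ℝ≥0∞}
    (h : ∀ ε : ℝ≥0∞, ε ≠ 0 → ∃ f' : X → ℝ, AEMeasurable (fun x => |f' x - f x|) (m.restrict U) ∧
      Appr m f' U (c + ε) ∧ ∫⁻ x in U, ENNReal.ofReal |f' x - f x| ∂m ≤ ε) :
    Appr m f U c := fun ε hε => by
  have hε2 : ε / 2 ≠ 0 := (ENNReal.half_pos hε).ne'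
  obtain ⟨f', hm, h1, h2⟩ := h _ hε2
  obtain ⟨g, h3, h4, h5⟩ := h1 _ hε2
  refine ⟨g, h3, ?_, ?_⟩
  · calc ∫⁻ x in U, ENNReal.ofReal |g x - f x| ∂m
        ≤ ∫⁻ x in U, (ENNReal.ofReal |g x - f' x| + ENNReal.ofReal |f' x - f x|) ∂m :=
          lintegral_mono fun x => ofReal_abs_sub_le _ _ _
      _ = _ := lintegral_add_right' _ hm.ennreal_ofReal
      _ ≤ ε / 2 + ε / 2 := add_le_add h4 h2
      _ = ε := ENNReal.add_halves ε
  · rwa [add_assoc, ENNReal.add_halves] at h5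

lemma Appr.add [BorelSpace X] {f f' : X → ℝ} {U : Set X} (hU : IsOpen U) (hf : Measurable f)
    {c c' : ℝ≥0∞} (h : Appr m f U c) (h' : Appr m f' U c') :
    Appr m (fun x => f x + f' x) U (c + c') := fun ε hε => by
  have hε2 : ε / 2 ≠ 0 := (ENNReal.half_pos hε).ne'
  obtain ⟨g, h1, h2, h3⟩ := h _ hε2
  obtain ⟨g', h1', h2', h3'⟩ := h' _ hε2
  refine ⟨fun x => g x + g' x, h1.add hU h1', ?_, ?_⟩
  · calc ∫⁻ x in U, ENNReal.ofReal |g x + g' x - (f x + f' x)| ∂m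
        ≤ ∫⁻ x in U, (ENNReal.ofReal |g x - f x| + ENNReal.ofReal |g' x - f' x|) ∂m := by
          refine lintegral_mono fun x => ?_
          rw [← ENNReal.ofReal_add (abs_nonneg _) (abs_nonneg _)]
          apply ENNReal.ofReal_le_ofReal
          rw [add_sub_add_comm]
          exact abs_add_le _ _
      _ = _ := lintegral_add_left' (aemeasurable_abs_sub hU h1 hf) _
      _ ≤ ε / 2 + ε / 2 := add_le_add h2 h2'
      _ = ε := ENNReal.add_halves ε
  · calc ∫⁻ x in U, mSlope (fun x => g x + g' x) x ∂m
        ≤ ∫⁻ x in U, (mSlope g x + mSlope g' x) ∂m := lintegral_mono fun x => mSlope_add_le _ _ _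
      _ = _ := lintegral_add_left' (aemeasurable_mSlope hU h1) _
      _ ≤ (c + ε / 2) + (c' + ε / 2) := add_le_add h3 h3'
      _ = c + c' + (ε / 2 + ε / 2) := by ring
      _ = _ := by rw [ENNReal.add_halves]

lemma Appr.const_mul [BorelSpace X] {f : X → ℝ} {U : Set X} (hU : IsOpen U) (a : ℝ)
    {c : ℝ≥0∞} (h : Appr m f U c) :
    Appr m (fun x => a * f x) U (ENNReal.ofReal |a| * c) := fun ε hε => by
  obtain ⟨δ, hδ, hδε⟩ : ∃ δ : ℝ≥0∞, δ ≠ 0 ∧ ENNReal.ofReal |a| * δ ≤ ε := by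
    refine ⟨ε / (ENNReal.ofReal |a| + 1), ENNReal.div_ne_zero.2 ⟨hε, by simp⟩, ?_⟩
    rw [← mul_div_assoc]
    refine ENNReal.div_le_of_le_mul ?_
    rw [mul_comm]
    gcongr
    exact le_self_add
  obtain ⟨g, h1, h2, h3⟩ := h _ hδ
  have hl : LipschitzWith ‖a‖₊ (fun t : ℝ => a * t) := lipschitzWith_smul a
  refine ⟨fun x => a * g x, h1.comp hU hl, ?_, ?_⟩
  · refine le_trans ?_ hδε
    simp only [← mul_sub, abs_mul, ENNReal.ofReal_mul (abs_nonneg a)]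
    rw [lintegral_const_mul' _ _ ENNReal.ofReal_ne_top]
    gcongr
  · calc ∫⁻ x in U, mSlope (fun x => a * g x) x ∂m
        ≤ ∫⁻ x in U, ENNReal.ofReal |a| * mSlope g x ∂m := by
          refine lintegral_mono fun x => ?_
          have := mSlope_comp_le g hl x
          rwa [← Real.enorm_eq_ofReal_abs]
      _ = ENNReal.ofReal |a| * ∫⁻ x in U, mSlope g x ∂m :=
          lintegral_const_mul' _ _ ENNReal.ofReal_ne_top
      _ ≤ ENNReal.ofReal |a| * (c + δ) := by gcongr
      _ ≤ _ := by rw [mul_add]; gcongr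

lemma appr_const (a : ℝ) (U : Set X) : Appr m (fun _ : X => a) U 0 := fun ε _ =>
  ⟨fun _ => a, fun _ _ => ⟨1, one_pos, 0, (LipschitzWith.const a).lipschitzOnWith⟩, by simp,
    by simp [mSlope_const]⟩

lemma Appr.sum [BorelSpace X] {ι : Type*} (s : Finset ι) {f : ι → X → ℝ} {U : Set X}
    (hU : IsOpen U) (hf : ∀ i, Measurable (f i)) {c : ι → ℝ≥0∞}
    (h : ∀ i ∈ s, Appr m (f i) U (c i)) :
    Appr m (fun x => ∑ i ∈ s, f i x) U (∑ i ∈ s, c i) := by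
  classical
  induction s using Finset.induction_on with
  | empty => simpa using appr_const 0 U
  | insert a s ha ih =>
    simp only [Finset.sum_insert ha]
    exact (h a (by simp)).add hU (hf a) (ih fun i hi => h i (by simp [hi]))

lemma lipschitzWith_clamp (a b : ℝ) : LipschitzWith 1 fun t : ℝ => max a (min t b) :=
  (LipschitzWith.id.min_const b).const_max a

lemma appr_of_totVar_le [CompleteSpace X] [TopologicalSpace.SeparableSpace X] [BorelSpace X]
    {f : X → ℝ} {U : Set X} (hU : IsOpen U) (hmU : m U ≠ ∞)
    {M : ℝ} (hM : ∀ x ∈ U, |f x| ≤ M) {c : ℝ≥0∞} (hc : c ≠ ∞) (h : totVar m f U ≤ c) :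
    Appr m f U c := fun ε hε => by
  obtain ⟨fn, h1, h2, h3⟩ := exists_seq_of_totVar_open_lt
    (h.trans_lt (ENNReal.lt_add_right hc hε))
  have hε2 : ε / 2 ≠ 0 := (ENNReal.half_pos hε).ne'
  obtain ⟨δ, hδ, hδε⟩ : ∃ δ : ℝ≥0∞, δ ≠ 0 ∧ ENNReal.ofReal (2 * M) * δ ≤ ε / 2 := by
    refine ⟨ε / 2 / (ENNReal.ofReal (2 * M) + 1), ENNReal.div_ne_zero.2 ⟨hε2,
      ENNReal.add_ne_top.2 ⟨ENNReal.ofReal_ne_top, ENNReal.one_ne_top⟩⟩, ?_⟩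
    rw [← mul_div_assoc]
    refine ENNReal.div_le_of_le_mul ?_
    rw [mul_comm]
    gcongr
    exact le_self_add
  obtain ⟨K, hKU, hK, hmK⟩ : ∃ K ⊆ U, IsCompact K ∧ m (U \ K) < δ := by
    have : Fact (m U < ∞) := ⟨hmU.lt_top⟩
    have : SecondCountableTopology X := UniformSpace.secondCountable_of_separable X
    obtain ⟨K, hK, hc, hm⟩ := hU.measurableSet.exists_isCompact_sdiff_lt
      (μ := m.restrict U) (measure_ne_top _ _) hδ
    refine ⟨K, hK, hc, ?_⟩
    rwa [Measure.restrict_apply (hU.measurableSet.diff hc.measurableSet),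
      inter_eq_left.2 Set.sdiff_subset] at hm
  obtain ⟨n, hn1, hn2⟩ := ((frequently_lt_of_liminf_lt (by isBoundedDefault) h3).and_eventually
    ((h2 K hKU hK).eventually_lt_const (pos_iff_ne_zero.2 hε2))).exists
  have hl := lipschitzWith_clamp (-M) M
  refine ⟨fun x => max (-M) (min (fn n x) M), (h1 n).comp hU hl, ?_, ?_⟩
  · have hcl : ∀ x ∈ U, max (-M) (min (f x) M) = f x := fun x hx => by
      obtain ⟨h1, h2⟩ := abs_le.1 (hM x hx)
      rw [min_eq_left h2, max_eq_right h1]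
    calc ∫⁻ x in U, ENNReal.ofReal |max (-M) (min (fn n x) M) - f x| ∂m
        ≤ ∫⁻ x in K ∪ (U \ K), ENNReal.ofReal |max (-M) (min (fn n x) M) - f x| ∂m := by
          rw [Set.union_sdiff_cancel hKU]
      _ ≤ ∫⁻ x in K, ENNReal.ofReal |max (-M) (min (fn n x) M) - f x| ∂m +
          ∫⁻ x in U \ K, ENNReal.ofReal |max (-M) (min (fn n x) M) - f x| ∂m :=
          lintegral_union_le _ _ _
      _ ≤ ∫⁻ x in K, ENNReal.ofReal |fn n x - f x| ∂m +
          ∫⁻ x in U \ K, ENNReal.ofReal (2 * M) ∂m := by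
          refine add_le_add (setLIntegral_mono' hK.measurableSet fun x hx => ?_)
            (setLIntegral_mono' (hU.measurableSet.diff hK.measurableSet) fun x hx => ?_)
          · apply ENNReal.ofReal_le_ofReal
            have := hl.dist_le_mul (fn n x) (f x)
            rw [hcl x (hKU hx)] at this
            simpa [Real.dist_eq] using this
          · apply ENNReal.ofReal_le_ofReal
            obtain ⟨h1, h2⟩ := abs_le.1 (hM x hx.1)
            have h3 : max (-M) (min (fn n x) M) ≤ M := max_le (by linarith) (min_le_right _ _)
            have h4 : -M ≤ max (-M) (min (fn n x) M) := le_max_left _ _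
            rw [abs_le]
            constructor <;> linarith
      _ ≤ ε / 2 + ε / 2 := by
          refine add_le_add hn2.le ?_
          rw [setLIntegral_const]
          exact le_trans (by gcongr) hδε
      _ = ε := ENNReal.add_halves ε
  · refine le_trans (lintegral_mono fun x => ?_) hn1.le
    simpa using mSlope_comp_le (fn n) hl x

end Approximation

section Gluing

variable [MetricSpace X]

lemma mSlope_le_mSlope {f g : X → ℝ} {x : X} (h : ∀ᶠ y in 𝓝 x, |f x - f y| ≤ |g x - g y|) :
    mSlope f x ≤ mSlope g x := by
  unfold mSlope slopeOn
  refine limsup_le_limsup ?_ (by isBoundedDefault) (by isBoundedDefault)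
  filter_upwards [nhdsWithin_le_nhds h] with y hy
  exact ENNReal.ofReal_le_ofReal (by gcongr)

lemma mSlope_sum_le {ι : Type*} (s : Finset ι) (f : ι → X → ℝ) (x : X) :
    mSlope (fun y => ∑ i ∈ s, f i y) x ≤ ∑ i ∈ s, mSlope (f i) x := by
  classical
  induction s using Finset.induction_on with
  | empty => simp [mSlope_const]
  | insert a s ha ih =>
    simp only [Finset.sum_insert ha]
    exact (mSlope_add_le _ _ x).trans (by gcongr)

lemma mSlope_cutoff_mul_le {φ g : X → ℝ} {C : NNReal} (hφ : LipschitzWith C φ)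
    (h0 : ∀ y, 0 ≤ φ y) (h1 : ∀ y, φ y ≤ 1) (a : ℝ) (x : X) :
    mSlope (fun y => φ y * (g y - a)) x ≤ mSlope g x + C * ENNReal.ofReal |g x - a| := by
  have e : (fun y => φ y * (g y - a)) = fun y => φ y * (g y - g x) + (g x - a) * φ y := by
    funext y; ring
  rw [e]
  refine (mSlope_add_le _ _ x).trans (add_le_add ?_ ?_)
  · refine mSlope_le_mSlope (Eventually.of_forall fun y => ?_)
    rw [sub_self, mul_zero, zero_sub, abs_neg, abs_mul, abs_sub_comm (g x), abs_of_nonneg (h0 y)]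
    exact mul_le_of_le_one_left (abs_nonneg _) (h1 y)
  · have hl : LipschitzWith ‖g x - a‖₊ (fun t : ℝ => (g x - a) * t) := lipschitzWith_smul _
    refine (mSlope_comp_le φ hl x).trans ?_
    rw [mul_comm, ← Real.enorm_eq_ofReal_abs]
    exact mul_le_mul_left (mSlope_le_of_lipschitz hφ x) _

variable [MeasurableSpace X] [BorelSpace X] {m : Measure X}

lemma Appr.glue {ι : Type*} [Countable ι] {Ω : Set X} (hΩ : IsOpen Ω) {U : ι → Set X}
    (hU : ∀ i, IsOpen (U i)) {φ : ι → X → ℝ} {C : ι → NNReal}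
    (hφ : ∀ i, LipschitzWith (C i) (φ i)) (h0 : ∀ i y, 0 ≤ φ i y) (h1 : ∀ i y, φ i y ≤ 1)
    (hsupp : ∀ x ∈ Ω, ∀ i, x ∉ U i → ∀ᶠ y in 𝓝 x, φ i y = 0)
    (hone : ∀ x ∈ Ω, ∃ N : Finset ι, ∀ᶠ y in 𝓝 x, (∀ i ∉ N, φ i y = 0) ∧ ∑ i ∈ N, φ i y = 1)
    {f : X → ℝ} (hf : Measurable f) {c : ι → ℝ≥0∞} (h : ∀ i, Appr m f (U i) (c i)) :
    Appr m f Ω (∑' i, c i) := fun ε hε => by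
  classical
  obtain ⟨e, he, hes⟩ := ENNReal.exists_pos_sum_of_countable' hε ι
  have hC : ∀ i, (C i + 1 : ℝ≥0∞) ≠ 0 := fun i => by simp
  have hC' : ∀ i, (C i + 1 : ℝ≥0∞) ≠ ∞ := fun i => by simp
  choose g hg hgf hgs using fun i => h i (e i / (C i + 1)) (ENNReal.div_ne_zero.2 ⟨(he i).ne', hC' i⟩)
  have hdiv : ∀ i, e i / (C i + 1) + C i * (e i / (C i + 1)) = e i := fun i => by
    rw [← one_add_mul, add_comm 1, ENNReal.mul_div_cancel (hC i) (hC' i)]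
  have key : ∀ x ∈ Ω, ∃ s : Finset ι, (∀ i ∈ s, x ∈ U i) ∧
      ∀ᶠ y in 𝓝 x, (∀ i ∉ s, φ i y = 0) ∧ ∑ i ∈ s, φ i y = 1 := fun x hx => by
    obtain ⟨N, hN⟩ := hone x hx
    refine ⟨N.filter fun i => x ∈ U i, fun i hi => (Finset.mem_filter.1 hi).2, ?_⟩
    have hN' : ∀ᶠ y in 𝓝 x, ∀ i ∈ N.filter fun i => x ∉ U i, φ i y = 0 :=
      (Finset.eventually_all _).2 fun i hi => hsupp x hx i (Finset.mem_filter.1 hi).2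
    filter_upwards [hN, hN'] with y hy hy'
    have h0 : ∀ i ∉ N.filter (fun i => x ∈ U i), φ i y = 0 := fun i hi => by
      by_cases hiN : i ∈ N
      · exact hy' i (by simp_all)
      · exact hy.1 i hiN
    refine ⟨h0, ?_⟩
    rw [← hy.2]
    exact Finset.sum_subset (Finset.filter_subset _ _) fun i _ hi => h0 i hi
  let u : X → ℝ := fun y => ∑' i, φ i y * g i y
  have hu : ∀ (s : Finset ι) (y : X) (a : ℝ), (∀ i ∉ s, φ i y = 0) → ∑ i ∈ s, φ i y = 1 →
      u y = ∑ i ∈ s, φ i y * (g i y - a) + a := fun s y a h h' => by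
    simp only [u, mul_sub, Finset.sum_sub_distrib, ← Finset.sum_mul, h', one_mul, sub_add_cancel]
    exact tsum_eq_sum fun i hi => by rw [h i hi, zero_mul]
  refine ⟨u, (locLipOn_iff hΩ).2 fun x hx => ?_, ?_, ?_⟩
  · obtain ⟨s, hs, hev⟩ := key x hx
    refine LipNear.congr (f := fun y => ∑ i ∈ s, φ i y * g i y) (LipNear.sum s fun i hi =>
      ((hφ i).lipNear x).mul ((locLipOn_iff (hU i)).1 (hg i) x (hs i hi))) ?_
    filter_upwards [hev] with y hy
    simpa using (hu s y 0 hy.1 hy.2).symm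
  · calc ∫⁻ x in Ω, ENNReal.ofReal |u x - f x| ∂m
        ≤ ∫⁻ x in Ω, ∑' i, (U i).indicator (fun x => ENNReal.ofReal |g i x - f x|) x ∂m := by
          refine setLIntegral_mono' hΩ.measurableSet fun x hx => ?_
          obtain ⟨s, hs, hev⟩ := key x hx
          have := hev.self_of_nhds
          rw [hu s x (f x) this.1 this.2, add_sub_cancel_right]
          refine le_trans ?_ (ENNReal.sum_le_tsum s)
          refine (ENNReal.ofReal_le_ofReal (Finset.abs_sum_le_sum_abs _ _)).trans ?_
          rw [ENNReal.ofReal_sum_of_nonneg fun _ _ => abs_nonneg _]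
          refine Finset.sum_le_sum fun i hi => ?_
          rw [indicator_of_mem (hs i hi), abs_mul, abs_of_nonneg (h0 i x)]
          exact ENNReal.ofReal_le_ofReal (mul_le_of_le_one_left (abs_nonneg _) (h1 i x))
      _ ≤ ∫⁻ x, ∑' i, (U i).indicator (fun x => ENNReal.ofReal |g i x - f x|) x ∂m :=
          setLIntegral_le_lintegral _ _
      _ = ∑' i, ∫⁻ x in U i, ENNReal.ofReal |g i x - f x| ∂m := by
          rw [lintegral_tsum fun i => (aemeasurable_indicator_iff (hU i).measurableSet).2
            (aemeasurable_abs_sub (hU i) (hg i) hf)]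
          exact tsum_congr fun i => lintegral_indicator (hU i).measurableSet _
      _ ≤ ∑' i, e i := by
          refine ENNReal.tsum_le_tsum fun i => (hgf i).trans ?_
          conv_rhs => rw [← hdiv i]
          exact le_self_add
      _ ≤ ε := hes.le
  · have hm : ∀ i, AEMeasurable (fun x => mSlope (g i) x + C i * ENNReal.ofReal |g i x - f x|)
        (m.restrict (U i)) := fun i =>
      (aemeasurable_mSlope (hU i) (hg i)).add
        ((aemeasurable_abs_sub (hU i) (hg i) hf).const_mul _)
    calc ∫⁻ x in Ω, mSlope u x ∂m
        ≤ ∫⁻ x in Ω, ∑' i, (U i).indicator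
            (fun x => mSlope (g i) x + C i * ENNReal.ofReal |g i x - f x|) x ∂m := by
          refine setLIntegral_mono' hΩ.measurableSet fun x hx => ?_
          obtain ⟨s, hs, hev⟩ := key x hx
          rw [mSlope_congr (g := fun y => ∑ i ∈ s, φ i y * (g i y - f x) + f x)
            (hev.mono fun y hy => hu s y (f x) hy.1 hy.2)]
          refine (mSlope_add_le _ _ x).trans ?_
          rw [mSlope_const, add_zero]
          refine le_trans ?_ (ENNReal.sum_le_tsum s)
          refine (mSlope_sum_le s _ x).trans (Finset.sum_le_sum fun i hi => ?_)
          rw [indicator_of_mem (hs i hi)]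
          exact mSlope_cutoff_mul_le (hφ i) (h0 i) (h1 i) _ x
      _ ≤ ∫⁻ x, ∑' i, (U i).indicator
            (fun x => mSlope (g i) x + C i * ENNReal.ofReal |g i x - f x|) x ∂m :=
          setLIntegral_le_lintegral _ _
      _ = ∑' i, ∫⁻ x in U i, (mSlope (g i) x + C i * ENNReal.ofReal |g i x - f x|) ∂m := by
          rw [lintegral_tsum fun i => (aemeasurable_indicator_iff (hU i).measurableSet).2 (hm i)]
          exact tsum_congr fun i => lintegral_indicator (hU i).measurableSet _
      _ ≤ ∑' i, (c i + e i) := by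
          refine ENNReal.tsum_le_tsum fun i => ?_
          rw [lintegral_add_left' (aemeasurable_mSlope (hU i) (hg i)),
            lintegral_const_mul' _ _ ENNReal.coe_ne_top, ← hdiv i, ← add_assoc]
          exact add_le_add (hgs i) (by gcongr; exact hgf i)
      _ = ∑' i, c i + ∑' i, e i := ENNReal.tsum_add
      _ ≤ _ := by gcongr

end Gluing

section Cutoff

variable [MetricSpace X]

lemma exists_lipschitz_pos_iff {A : Set X} (hA : IsOpen A) :
    ∃ ρ : X → ℝ, LipschitzWith 1 ρ ∧ (∀ x, 0 ≤ ρ x) ∧ (∀ x, ρ x ≤ 1) ∧ {x | 0 < ρ x} = A := by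
  by_cases h : Aᶜ.Nonempty
  · refine ⟨fun x => min (infDist x Aᶜ) 1, (lipschitz_infDist_pt _).min_const 1,
      fun x => le_min infDist_nonneg zero_le_one, fun x => min_le_right _ _, ?_⟩
    ext x
    have := hA.isClosed_compl.notMem_iff_infDist_pos h (x := x)
    simp only [mem_compl_iff, not_not] at this
    simp [this, mem_ofPred_eq]
  · have : A = univ := by simpa [not_nonempty_iff_eq_empty] using h
    exact ⟨fun _ => 1, (LipschitzWith.const 1).weaken zero_le_one, by simp, by simp, by simp [this]⟩

lemma exists_lipschitz_cutoff {ρ : X → ℝ} {K : NNReal} (hρ : LipschitzWith K ρ) {a b : ℝ}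
    (hab : a < b) : ∃ (τ : X → ℝ) (C : NNReal), LipschitzWith C τ ∧ (∀ x, 0 ≤ τ x) ∧
      (∀ x, τ x ≤ 1) ∧ (∀ x, ρ x ≤ a → τ x = 0) ∧ (∀ x, b ≤ ρ x → τ x = 1) := by
  have h1 : LipschitzWith ‖(b - a)⁻¹‖₊ (fun t : ℝ => (b - a)⁻¹ * t) := lipschitzWith_smul _
  have h2 := (lipschitzWith_clamp 0 1).comp (h1.comp (hρ.sub (LipschitzWith.const a)))
  have hpos : 0 < (b - a)⁻¹ := inv_pos.2 (sub_pos.2 hab)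
  refine ⟨fun x => max 0 (min ((b - a)⁻¹ * (ρ x - a)) 1), _, h2, fun x => le_max_left _ _,
    fun x => max_le zero_le_one (min_le_right _ _), fun x hx => ?_, fun x hx => ?_⟩
  · refine max_eq_left ((min_le_left _ _).trans ?_)
    exact mul_nonpos_of_nonneg_of_nonpos hpos.le (by linarith)
  · have : 1 ≤ (b - a)⁻¹ * (ρ x - a) := by
      rw [← inv_mul_cancel₀ (sub_pos.2 hab).ne']
      gcongr
    simp [min_eq_right this]

end Cutoff

section OuterMeasure

variable [MetricSpace X] [MeasurableSpace X] [BorelSpace X] {m : Measure X}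

lemma totVar_empty (m : Measure X) (f : X → ℝ) : totVar m f ∅ = 0 := by
  refine le_antisymm ?_ bot_le
  have := totVar_le_liminf (m := m) (f := f) (B := ∅) (fn := fun _ => f) isOpen_empty
    Subset.rfl (fun _ x hx => absurd hx (notMem_empty x)) (fun K _ _ => by simp)
  simpa using this

lemma tsum_totVar_le {ι : Type*} [Countable ι] (m : Measure X) (f : X → ℝ) {A U : ι → Set X}
    (hU : ∀ i, IsOpen (U i)) (hd : Pairwise (Function.onFun Disjoint U)) (hA : ∀ i, A i ⊆ U i) :
    ∑' i, totVar m f (A i) ≤ totVar m f (⋃ i, A i) := by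
  let _ : MeasurableSpace ι := ⊤
  have : DiscreteMeasurableSpace ι := ⟨fun _ => trivial⟩
  refine le_of_forall_gt fun c hc => ?_
  obtain ⟨Ω, hΩ, hB, fn, hfn, hlim, hc⟩ := exists_seq_of_totVar_lt hc
  refine lt_of_le_of_lt ?_ hc
  calc ∑' i, totVar m f (A i)
      ≤ ∑' i, liminf (fun n => ∫⁻ x in Ω ∩ U i, mSlope (fn n) x ∂m) atTop :=
        ENNReal.tsum_le_tsum fun i => totVar_le_liminf (hΩ.inter (hU i))
          (subset_inter ((subset_iUnion A i).trans hB) (hA i))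
          (fun n => (hfn n).mono inter_subset_left) (hlim.mono inter_subset_left)
    _ = ∫⁻ i, liminf (fun n => ∫⁻ x in Ω ∩ U i, mSlope (fn n) x ∂m) atTop ∂Measure.count :=
        (lintegral_count _).symm
    _ ≤ liminf (fun n => ∫⁻ i, ∫⁻ x in Ω ∩ U i, mSlope (fn n) x ∂m ∂Measure.count) atTop :=
        lintegral_liminf_le fun n => .of_discrete
    _ ≤ _ := by
        refine liminf_le_liminf (Eventually.of_forall fun n => ?_)
        rw [lintegral_count, ← lintegral_iUnion (fun i => (hΩ.inter (hU i)).measurableSet)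
          (fun i j h => (hd h).mono inter_subset_right inter_subset_right)]
        exact lintegral_mono_set (iUnion_subset fun i => inter_subset_left)

variable [CompleteSpace X] [TopologicalSpace.SeparableSpace X] [IsFiniteMeasure m]

lemma totVar_le_tsum_of_cutoff {ι : Type*} [Countable ι] {Ω : Set X} (hΩ : IsOpen Ω)
    {U : ι → Set X} (hU : ∀ i, IsOpen (U i)) {φ : ι → X → ℝ} {C : ι → NNReal}
    (hφ : ∀ i, LipschitzWith (C i) (φ i)) (h0 : ∀ i y, 0 ≤ φ i y) (h1 : ∀ i y, φ i y ≤ 1)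
    (hsupp : ∀ x ∈ Ω, ∀ i, x ∉ U i → ∀ᶠ y in 𝓝 x, φ i y = 0)
    (hone : ∀ x ∈ Ω, ∃ N : Finset ι, ∀ᶠ y in 𝓝 x, (∀ i ∉ N, φ i y = 0) ∧ ∑ i ∈ N, φ i y = 1)
    {f : X → ℝ} (hf : Measurable f) {M : ℝ} (hM : ∀ x, |f x| ≤ M) :
    totVar m f Ω ≤ ∑' i, totVar m f (U i) := by
  by_cases htop : ∑' i, totVar m f (U i) = ∞
  · simp [htop]
  · exact (Appr.glue hΩ hU hφ h0 h1 hsupp hone hf fun i => appr_of_totVar_le (hU i)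
      (measure_ne_top _ _) (fun x _ => hM x) (ENNReal.ne_top_of_tsum_ne_top htop i) le_rfl).totVar_le hΩ

end OuterMeasure

section Subadditivity

variable [MetricSpace X] [MeasurableSpace X] [BorelSpace X] {m : Measure X}

lemma tsum_totVar_window_ne_top {f ρ : X → ℝ} (hρ : Continuous ρ) {c : ℝ≥0∞} (hc : c ≠ ∞)
    (h : ∀ δ > 0, totVar m f {x | δ < ρ x} ≤ c) {a : ℕ → ℝ} (ha : StrictAnti a)
    (ha0 : ∀ k, 0 < a k) :
    ∑' k, totVar m f {x | a (k + 4) < ρ x ∧ ρ x < a k} ≠ ∞ := by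
  have hj : ∀ j : Fin 4, ∑' q : ℕ,
      totVar m f {x | a (q * 4 + j + 4) < ρ x ∧ ρ x < a (q * 4 + j)} ≤ c := fun j => by
    refine ENNReal.tsum_le_of_sum_range_le fun Q => ?_
    rw [Finset.sum_range, ← tsum_fintype (L := .unconditional _)]
    refine (tsum_totVar_le (ι := Fin Q) m f
      (U := fun q => {x | a (q * 4 + j + 4) < ρ x ∧ ρ x < a (q * 4 + j)})
      (fun q => (isOpen_lt continuous_const hρ).inter (isOpen_lt hρ continuous_const))
      ?_ fun q => Subset.rfl).trans
      ((totVar_mono m f (iUnion_subset fun q x hx => ?_)).trans (h _ (ha0 (Q * 4 + j + 4))))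
    · have key : ∀ p q : ℕ, p < q → Disjoint {x | a (p * 4 + j + 4) < ρ x ∧ ρ x < a (p * 4 + j)}
          {x | a (q * 4 + j + 4) < ρ x ∧ ρ x < a (q * 4 + j)} := fun p q hpq =>
        disjoint_left.2 fun x hx hx' =>
          absurd (hx.1.trans hx'.2) (not_lt.2 (ha.antitone (by omega)))
      intro p q hpq
      rcases lt_or_gt_of_ne hpq with h | h
      · exact key _ _ h
      · exact (key _ _ h).symm
    · exact (ha.antitone (by omega)).trans_lt hx.1
  rw [← (Nat.divModEquiv 4).symm.tsum_eq, ENNReal.tsum_prod',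
    ENNReal.tsum_comm, tsum_fintype]
  refine (ENNReal.sum_lt_top.2 fun j _ => (lt_of_le_of_lt ?_ hc.lt_top)).ne
  exact hj j

lemma totVar_union_of_areSeparated (m : Measure X) (f : X → ℝ) {A B : Set X}
    (h : AreSeparated A B) : totVar m f A + totVar m f B ≤ totVar m f (A ∪ B) := by
  obtain ⟨r, hr, h⟩ := h
  have hpos := pos_iff_ne_zero.2 hr
  have := tsum_totVar_le m f (A := fun b => cond b A B)
    (U := fun b => cond b {x | infEDist x A < infEDist x B} {x | infEDist x B < infEDist x A})
    (fun b => by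
      cases b
      · exact isOpen_lt continuous_infEDist continuous_infEDist
      · exact isOpen_lt continuous_infEDist continuous_infEDist)
    (pairwise_disjoint_on_bool.2 (disjoint_left.2 fun x
      (hx : infEDist x A < infEDist x B) (hx' : infEDist x B < infEDist x A) => lt_asymm hx hx'))
    (fun b => by
      cases b
      · intro x hx
        refine (infEDist_zero_of_mem hx).trans_lt (hpos.trans_le (le_infEDist.2 fun y hy => ?_))
        rw [edist_comm]
        exact h y hy x hx
      · intro x hx
        exact (infEDist_zero_of_mem hx).trans_lt (hpos.trans_le (le_infEDist.2 fun y hy =>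
          h x hx y hy)))
  rw [tsum_bool, add_comm] at this
  refine this.trans (totVar_mono m f (iUnion_subset fun b => ?_))
  cases b
  · exact subset_union_right
  · exact subset_union_left

variable [CompleteSpace X] [TopologicalSpace.SeparableSpace X] [IsFiniteMeasure m]

lemma totVar_pos_le_of_forall_gt {f : X → ℝ} (hf : Measurable f) {M : ℝ} (hM : ∀ x, |f x| ≤ M)
    {ρ : X → ℝ} {K : NNReal} (hρ : LipschitzWith K ρ) {c : ℝ≥0∞}
    (h : ∀ δ > 0, totVar m f {x | δ < ρ x} ≤ c) : totVar m f {x | 0 < ρ x} ≤ c := by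
  by_cases hc : c = ∞
  · simp [hc]
  let a : ℕ → ℝ := fun k => 1 / ((k : ℝ) + 1)
  have ha : StrictAnti a := fun i j hij =>
    one_div_lt_one_div_of_lt (by positivity) (by exact_mod_cast Nat.succ_lt_succ hij)
  have ha0 : ∀ k, 0 < a k := fun k => by positivity
  have halim : Tendsto a atTop (𝓝 0) := tendsto_one_div_add_atTop_nhds_zero_nat
  have hρc := hρ.continuous
  refine ENNReal.le_of_forall_pos_le_add fun ε hε _ => ?_
  obtain ⟨k, hk⟩ := ((ENNReal.tendsto_sum_nat_add _
    (tsum_totVar_window_ne_top hρc hc h ha ha0)).eventually_lt_const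
      (ENNReal.coe_pos.2 hε)).exists
  choose τ C hτ h0 h1 hlow hhigh using fun j => exists_lipschitz_cutoff hρ (ha (Nat.lt_succ_self j))
  let t : ℕ → X → ℝ := fun j => Nat.casesOn j (fun _ => 0) fun j => τ (k + j + 1)
  have ht : ∀ j, ∃ C, LipschitzWith C (t j) := fun j => by
    cases j with
    | zero => exact ⟨0, LipschitzWith.const 0⟩
    | succ j => exact ⟨_, hτ _⟩
  choose D hD using ht
  have ht0 : ∀ j x, 0 ≤ t j x := fun j x => by
    cases j with
    | zero => exact le_rfl
    | succ j => exact h0 _ _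
  have ht1 : ∀ j x, t j x ≤ 1 := fun j x => by
    cases j with
    | zero => exact zero_le_one
    | succ j => exact h1 _ _
  have htl : ∀ j x, ρ x ≤ a (k + j + 1) → t j x = 0 := fun j x hx => by
    cases j with
    | zero => rfl
    | succ j => exact hlow _ _ hx
  have hth : ∀ j x, a (k + j + 1) ≤ ρ x → t (j + 1) x = 1 := fun j x hx => hhigh _ _ hx
  let φ : ℕ → X → ℝ := fun j x => t (j + 1) x - t j x
  let U : ℕ → Set X := fun j =>
    Nat.casesOn j {x | a (k + 3) < ρ x} fun j => {x | a (j + k + 4) < ρ x ∧ ρ x < a (j + k)}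
  have hUo : ∀ j, IsOpen (U j) := fun j => by
    cases j with
    | zero => exact isOpen_lt continuous_const hρc
    | succ j => exact (isOpen_lt continuous_const hρc).inter (isOpen_lt hρc continuous_const)
  have hlowφ : ∀ j x, ρ x ≤ a (k + j + 2) → φ j x = 0 := fun j x hx => by
    simp only [φ]
    rw [htl (j + 1) x hx, htl j x (hx.trans (ha.antitone (by omega))), sub_zero]
  have hhighφ : ∀ j x, a (k + j + 1) ≤ ρ x → φ (j + 1) x = 0 := fun j x hx => by
    simp only [φ]
    rw [hth j x hx, hth (j + 1) x ((ha.antitone (by omega)).trans hx), sub_self]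
  have hglue : totVar m f {x | 0 < ρ x} ≤ ∑' j, totVar m f (U j) := by
    refine totVar_le_tsum_of_cutoff (isOpen_lt continuous_const hρc) hUo (φ := φ)
      (fun j => (hD (j + 1)).sub (hD j)) (fun j x => ?_) (fun j x => ?_) (fun x hx j hj => ?_)
      (fun x hx => ?_) hf hM
    · rcases le_total (ρ x) (a (k + j + 1)) with hx | hx
      · simp only [φ]
        rw [htl j x hx, sub_zero]
        exact ht0 (j + 1) x
      · simp only [φ]
        rw [hth j x hx]
        linarith [ht1 j x]
    · simp only [φ]
      linarith [ht0 j x, ht1 (j + 1) x]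
    · cases j with
      | zero =>
        have hx' : ρ x < a (k + 0 + 2) := (not_lt.1 hj).trans_lt (ha (by omega))
        filter_upwards [hρc.continuousAt.eventually_lt continuousAt_const hx'] with y hy
        exact hlowφ 0 y hy.le
      | succ j =>
        rcases lt_or_ge (a (j + k + 4)) (ρ x) with h4 | h4
        · have hx' : a (k + j + 1) < ρ x :=
            (ha (by omega)).trans_le (not_lt.1 fun h => hj ⟨h4, h⟩)
          filter_upwards [continuousAt_const.eventually_lt hρc.continuousAt hx'] with y hy
          exact hhighφ j y hy.le
        · have hx' : ρ x < a (k + (j + 1) + 2) := h4.trans_lt (ha (by omega))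
          filter_upwards [hρc.continuousAt.eventually_lt continuousAt_const hx'] with y hy
          exact hlowφ (j + 1) y hy.le
    · obtain ⟨n, hn⟩ := (halim.eventually_lt_const (show 0 < ρ x from hx)).exists
      refine ⟨Finset.range (n + 1), ?_⟩
      have hx' : a (k + n + 1) < ρ x := (ha.antitone (by omega)).trans_lt hn
      filter_upwards [continuousAt_const.eventually_lt hρc.continuousAt hx'] with y hy
      refine ⟨fun j hj => ?_, ?_⟩
      · obtain ⟨i, rfl⟩ : ∃ i, j = i + 1 := ⟨j - 1, by simp at hj; omega⟩
        simp at hj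
        exact hhighφ i y ((ha.antitone (by omega)).trans hy.le)
      · simp only [φ]
        rw [Finset.sum_range_sub (fun j => t j y), hth n y hy.le]
        exact sub_zero _
  refine hglue.trans ?_
  rw [tsum_eq_zero_add' ENNReal.summable]
  exact add_le_add (h _ (ha0 (k + 3))) hk.le

lemma totVar_union_le_of_isOpen {f : X → ℝ} (hf : Measurable f) {M : ℝ} (hM : ∀ x, |f x| ≤ M)
    {A B : Set X} (hA : IsOpen A) (hB : IsOpen B) :
    totVar m f (A ∪ B) ≤ totVar m f A + totVar m f B := by
  obtain ⟨p, hp, -, -, rfl⟩ := exists_lipschitz_pos_iff hA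
  obtain ⟨q, hq, -, -, rfl⟩ := exists_lipschitz_pos_iff hB
  have e : {x | 0 < p x} ∪ {x | 0 < q x} = {x | 0 < max (p x) (q x)} := by
    ext x; simp [mem_ofPred_eq]
  rw [e]
  refine totVar_pos_le_of_forall_gt hf hM (hp.max hq) fun δ hδ => ?_
  obtain ⟨τ, C, hτ, h0, h1, hlow, hhigh⟩ :=
    exists_lipschitz_cutoff (hp.sub hq) (show -(δ / 2) < δ / 2 by linarith)
  have hpc := hp.continuous
  have hqc := hq.continuous
  have := totVar_le_tsum_of_cutoff (m := m) (ι := Bool) (Ω := {x | δ < max (p x) (q x)})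
    (U := fun b => cond b {x | 0 < p x} {x | 0 < q x})
    (φ := fun b x => cond b (τ x) (1 - τ x))
    (C := fun b => cond b C (0 + C))
    (isOpen_lt continuous_const (hpc.max hqc))
    (fun b => by
      cases b
      · exact isOpen_lt continuous_const hqc
      · exact isOpen_lt continuous_const hpc)
    (fun b => by
      cases b
      · exact (LipschitzWith.const 1).sub hτ
      · exact hτ)
    (fun b y => by
      cases b
      · exact sub_nonneg.2 (h1 y)
      · exact h0 y)
    (fun b y => by
      cases b
      · exact sub_le_self _ (h0 y)
      · exact h1 y)
    (fun x hx b hb => by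
      have hx : δ < max (p x) (q x) := hx
      cases b
      · have hb : q x ≤ 0 := not_lt.1 hb
        have hp' : δ < p x := (lt_max_iff.1 hx).resolve_right (by linarith)
        have : ∀ᶠ y in 𝓝 x, δ / 2 < p y - q y :=
          continuousAt_const.eventually_lt (hpc.sub hqc).continuousAt (by linarith)
        filter_upwards [this] with y hy
        simp [hhigh y hy.le]
      · have hb : p x ≤ 0 := not_lt.1 hb
        have hp' : δ < q x := (lt_max_iff.1 hx).resolve_left (by linarith)
        have : ∀ᶠ y in 𝓝 x, p y - q y < -(δ / 2) :=
          (hpc.sub hqc).continuousAt.eventually_lt continuousAt_const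
            (show p x - q x < -(δ / 2) by linarith)
        filter_upwards [this] with y hy
        simp [hlow y hy.le])
    (fun x _ => ⟨Finset.univ, by simp⟩) hf hM
  simpa [tsum_bool, add_comm] using this

lemma totVar_iUnion_le_of_isOpen {f : X → ℝ} (hf : Measurable f) {M : ℝ} (hM : ∀ x, |f x| ≤ M)
    {A : ℕ → Set X} (hA : ∀ i, IsOpen (A i)) :
    totVar m f (⋃ i, A i) ≤ ∑' i, totVar m f (A i) := by
  have hfin : ∀ n, totVar m f (⋃ i < n, A i) ≤ ∑ i ∈ Finset.range n, totVar m f (A i) := fun n => by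
    induction n with
    | zero => simp [totVar_empty]
    | succ n ih =>
      rw [Finset.sum_range_succ, biUnion_lt_succ]
      refine (totVar_union_le_of_isOpen hf hM (isOpen_iUnion fun i => isOpen_iUnion fun _ => hA i)
        (hA n)).trans ?_
      gcongr
  choose p hp hp0 hp1 hpA using fun i => exists_lipschitz_pos_iff (hA i)
  let w : ℕ → ℝ := fun i => 1 / ((i : ℝ) + 1)
  have hw0 : ∀ i, 0 < w i := fun i => by positivity
  have hw1 : ∀ i, w i ≤ 1 := fun i => div_le_one_of_le₀ (by simp) (by positivity)
  have hwlim : Tendsto w atTop (𝓝 0) := tendsto_one_div_add_atTop_nhds_zero_nat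
  let ρ : X → ℝ := fun x => ⨆ i, w i * p i x
  have hle : ∀ i x, w i * p i x ≤ w i := fun i x => mul_le_of_le_one_right (hw0 i).le (hp1 i x)
  have hbdd : ∀ x, BddAbove (range fun i => w i * p i x) := fun x =>
    ⟨1, by rintro _ ⟨i, rfl⟩; exact (hle i x).trans (hw1 i)⟩
  have hρ : LipschitzWith 1 ρ := LipschitzWith.of_le_add fun x y => ciSup_le fun i => by
    have h1 : p i x ≤ p i y + dist x y := by simpa using (hp i).le_add_mul x y
    calc w i * p i x ≤ w i * (p i y + dist x y) := by gcongr
      _ ≤ w i * p i y + dist x y := by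
        rw [mul_add]
        gcongr
        exact mul_le_of_le_one_left dist_nonneg (hw1 i)
      _ ≤ _ := by gcongr; exact le_ciSup (hbdd y) i
  have e : ⋃ i, A i = {x | 0 < ρ x} := by
    ext x
    simp only [mem_iUnion, ← hpA, mem_ofPred_eq, ρ]
    rw [lt_ciSup_iff (hbdd x)]
    exact exists_congr fun i => (mul_pos_iff_of_pos_left (hw0 i)).symm
  rw [e]
  refine totVar_pos_le_of_forall_gt hf hM hρ fun δ hδ => ?_
  obtain ⟨n, hn⟩ := eventually_atTop.1 (hwlim.eventually_lt_const hδ)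
  refine (totVar_mono m f fun x hx => ?_).trans ((hfin n).trans (ENNReal.sum_le_tsum _))
  obtain ⟨i, hi⟩ := (lt_ciSup_iff (hbdd x)).1 (show δ < ρ x from hx)
  refine mem_iUnion₂.2 ⟨i, ?_, ?_⟩
  · by_contra h
    linarith [hn i (not_lt.1 h), hle i x]
  · rw [← hpA]
    exact (mul_pos_iff_of_pos_left (hw0 i)).1 (hδ.trans hi)

lemma totVar_iUnion_le {f : X → ℝ} (hf : Measurable f) {M : ℝ} (hM : ∀ x, |f x| ≤ M)
    (A : ℕ → Set X) : totVar m f (⋃ i, A i) ≤ ∑' i, totVar m f (A i) := by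
  refine ENNReal.le_of_forall_pos_le_add fun ε hε hlt => ?_
  obtain ⟨e, he, hes⟩ := ENNReal.exists_pos_sum_of_countable' (ENNReal.coe_ne_zero.2 hε.ne') ℕ
  choose Ω hΩ hAΩ hlt using fun i => exists_open_totVar_lt
    (ENNReal.lt_add_right (ENNReal.ne_top_of_tsum_ne_top hlt.ne i) (he i).ne')
  calc totVar m f (⋃ i, A i) ≤ totVar m f (⋃ i, Ω i) := totVar_mono m f (iUnion_mono hAΩ)
    _ ≤ ∑' i, totVar m f (Ω i) := totVar_iUnion_le_of_isOpen hf hM hΩ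
    _ ≤ ∑' i, (totVar m f (A i) + e i) := ENNReal.tsum_le_tsum fun i => (hlt i).le
    _ = ∑' i, totVar m f (A i) + ∑' i, e i := ENNReal.tsum_add
    _ ≤ _ := by gcongr

lemma exists_measure_eq_totVar {f : X → ℝ} (hf : Measurable f) {M : ℝ} (hM : ∀ x, |f x| ≤ M) :
    ∃ μ : Measure X, ∀ B, MeasurableSet B → μ B = totVar m f B := by
  let ν : OuterMeasure X :=
    { measureOf := totVar m f
      empty := totVar_empty m f
      mono := totVar_mono m f
      iUnion_nat := fun A _ => totVar_iUnion_le hf hM A }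
  have hν : ν.IsMetric := fun A B h =>
    le_antisymm (measure_union_le _ _) (totVar_union_of_areSeparated m f h)
  have hle : ‹MeasurableSpace X› ≤ ν.caratheodory :=
    (BorelSpace.measurable_eq (α := X)).le.trans hν.borel_le_caratheodory
  exact ⟨ν.toMeasure hle, fun B hB => toMeasure_apply _ _ hB⟩

end Subadditivity

section Ramp

/-- The piecewise affine function of `a` equal to `1` for `a ≤ t - 1 / N` and to `0` for `t ≤ a`. -/
def ramp (N t a : ℝ) : ℝ := max 0 (min (N * (t - a)) 1)

lemma ramp_nonneg (N t a : ℝ) : 0 ≤ ramp N t a := le_max_left _ _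

lemma ramp_le_one (N t a : ℝ) : ramp N t a ≤ 1 := max_le zero_le_one (min_le_right _ _)

lemma ramp_of_le {N t a : ℝ} (hN : 0 < N) (h : t ≤ a) : ramp N t a = 0 :=
  max_eq_left ((min_le_left _ _).trans (mul_nonpos_of_nonneg_of_nonpos hN.le (by linarith)))

lemma ramp_of_ge {N t a : ℝ} (hN : 0 < N) (h : a + 1 / N ≤ t) : ramp N t a = 1 := by
  have : 1 ≤ N * (t - a) := by
    rw [← mul_one_div_cancel hN.ne']
    gcongr
    linarith
  simp [ramp, min_eq_right this]

lemma lipschitzWith_ramp (N t : ℝ) : LipschitzWith ‖N‖₊ (ramp N t) := by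
  have h1 : LipschitzWith ‖N‖₊ (fun a : ℝ => N * a) := lipschitzWith_smul N
  have h2 : LipschitzWith 1 (fun a : ℝ => t - a) := by
    simpa using (LipschitzWith.const t).sub LipschitzWith.id
  have := (lipschitzWith_clamp 0 1).comp (h1.comp h2)
  rwa [one_mul, mul_one] at this

lemma lintegral_abs_ramp_sub_le {N : ℝ} (hN : 0 < N) (a b : ℝ) :
    ∫⁻ t, ENNReal.ofReal |ramp N t a - (if b < t then 1 else 0)| ≤
      ENNReal.ofReal |a - b| + ENNReal.ofReal (1 / N) := by
  have hN' : 0 < 1 / N := by positivity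
  rw [← ENNReal.ofReal_add (abs_nonneg _) hN'.le]
  calc ∫⁻ t, ENNReal.ofReal |ramp N t a - (if b < t then 1 else 0)|
      ≤ ∫⁻ t, (Icc (min a b) (max a b + 1 / N)).indicator 1 t := by
        refine lintegral_mono fun t => ?_
        by_cases ht : t ∈ Icc (min a b) (max a b + 1 / N)
        · rw [indicator_of_mem ht, Pi.one_apply, ENNReal.ofReal_le_one, abs_le]
          have h0 := ramp_nonneg N t a
          have h1 := ramp_le_one N t a
          split_ifs <;> constructor <;> linarith
        · rw [indicator_of_notMem ht]
          rw [mem_Icc, not_and_or, not_le, not_le] at ht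
          rcases ht with ht | ht
          · rw [lt_min_iff] at ht
            simp [ramp_of_le hN ht.1.le, not_lt.2 ht.2.le]
          · have ha : a + 1 / N ≤ t := (add_le_add_left (le_max_left a b) _).trans ht.le
            have hb : b < t := by linarith [le_max_right a b]
            simp [ramp_of_ge hN ha, hb]
    _ = ENNReal.ofReal (|a - b| + 1 / N) := by
        rw [lintegral_indicator_one measurableSet_Icc, Real.volume_Icc, ← max_sub_min_eq_abs,
          max_comm, min_comm]
        congr 1
        ring

end Ramp

lemma mSlope_ramp_le [MetricSpace X] {N : ℝ} (hN : 0 < N) (t : ℝ) {g : X → ℝ} {x : X} (hg : ContinuousAt g x) :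
    mSlope (fun y => ramp N t (g y)) x ≤
      (Icc (g x) (g x + 1 / N)).indicator (fun _ => ENNReal.ofReal N) t * mSlope g x := by
  by_cases ht : t ∈ Icc (g x) (g x + 1 / N)
  · rw [indicator_of_mem ht]
    have := mSlope_comp_le g (lipschitzWith_ramp N t) x
    rwa [← Real.enorm_of_nonneg hN.le]
  · rw [indicator_of_notMem ht, zero_mul]
    rw [mem_Icc, not_and_or, not_le, not_le] at ht
    rcases ht with ht | ht
    · rw [mSlope_congr (g := fun _ => 0), mSlope_const]
      filter_upwards [continuousAt_const.eventually_lt hg ht] with y hy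
      exact ramp_of_le hN hy.le
    · rw [mSlope_congr (g := fun _ => 1), mSlope_const]
      filter_upwards [(hg.add continuousAt_const).eventually_lt continuousAt_const ht] with y hy
      exact ramp_of_ge hN hy.le

section Tonelli

variable [MeasurableSpace X] {m : Measure X}

lemma lintegral_ramp_slope {N : ℝ} (hN : 0 < N) [SFinite m] {g : X → ℝ} {w : X → ℝ≥0∞}
    (hg : Measurable g) (hw : Measurable w) :
    (Measurable fun t =>
      ∫⁻ x, (Icc (g x) (g x + 1 / N)).indicator (fun _ => ENNReal.ofReal N) t * w x ∂m) ∧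
    ∫⁻ t, ∫⁻ x, (Icc (g x) (g x + 1 / N)).indicator (fun _ => ENNReal.ofReal N) t * w x ∂m =
      ∫⁻ x, w x ∂m := by
  have hm : Measurable fun p : ℝ × X =>
      (Icc (g p.2) (g p.2 + 1 / N)).indicator (fun _ => ENNReal.ofReal N) p.1 * w p.2 := by
    refine Measurable.mul ?_ (hw.comp measurable_snd)
    have hg2 : Measurable fun p : ℝ × X => g p.2 := hg.comp measurable_snd
    exact Measurable.ite ((measurableSet_le hg2 measurable_fst).inter
      (measurableSet_le measurable_fst (hg2.add_const _))) measurable_const measurable_const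
  refine ⟨hm.lintegral_prod_right', ?_⟩
  rw [lintegral_lintegral_swap hm.aemeasurable]
  refine lintegral_congr fun x => ?_
  rw [lintegral_mul_const _ (measurable_const.indicator measurableSet_Icc),
    lintegral_indicator measurableSet_Icc, setLIntegral_const, Real.volume_Icc, add_sub_cancel_left,
    ← ENNReal.ofReal_mul hN.le, mul_one_div_cancel hN.ne', ENNReal.ofReal_one, one_mul]

lemma lintegral_abs_ramp_comp_sub_le {N : ℝ} (hN : 0 < N) [SFinite m] {g u : X → ℝ}
    (hg : Measurable g) (hu : Measurable u) :
    (Measurable fun t =>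
      ∫⁻ x, ENNReal.ofReal |ramp N t (g x) - {x | u x < t}.indicator (fun _ => 1) x| ∂m) ∧
    ∫⁻ t, ∫⁻ x, ENNReal.ofReal |ramp N t (g x) - {x | u x < t}.indicator (fun _ => 1) x| ∂m ≤
      ∫⁻ x, ENNReal.ofReal |g x - u x| ∂m + ENNReal.ofReal (1 / N) * m univ := by
  have hm : Measurable fun p : ℝ × X =>
      ENNReal.ofReal |ramp N p.1 (g p.2) - {x | u x < p.1}.indicator (fun _ => 1) p.2| := by
    have hg2 : Measurable fun p : ℝ × X => g p.2 := hg.comp measurable_snd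
    have hu2 : Measurable fun p : ℝ × X => u p.2 := hu.comp measurable_snd
    refine (continuous_abs.measurable.comp (Measurable.sub ?_ ?_)).ennreal_ofReal
    · exact measurable_const.max (((measurable_fst.sub hg2).const_mul _).min measurable_const)
    · exact Measurable.ite (measurableSet_lt hu2 measurable_fst) measurable_const measurable_const
  refine ⟨hm.lintegral_prod_right', ?_⟩
  rw [lintegral_lintegral_swap hm.aemeasurable, ← lintegral_const,
    ← lintegral_add_right _ measurable_const]
  refine lintegral_mono fun x => ?_
  simpa only [indicator_apply, mem_ofPred_eq] using lintegral_abs_ramp_sub_le hN (g x) (u x)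

end Tonelli

section Coarea

variable [MetricSpace X] [MeasurableSpace X] [BorelSpace X] {m : Measure X}

lemma lintegral_per_sublevel_le [IsFiniteMeasure m] {Ω : Set X} (hΩ : IsOpen Ω) {u : X → ℝ}
    (hu : Measurable u) {c : ℝ≥0∞} (h : Appr m u Ω c) :
    ∫⁻ t, Per m {x | u x < t} Ω ≤ c := by
  classical
  let e : ℕ → ℝ≥0∞ := fun j => 2⁻¹ ^ j
  have he : ∀ j, e j ≠ 0 := fun j => pow_ne_zero _ (by simp)
  have hsum : ∑' j, e j ≠ ∞ := by
    simp only [e, ENNReal.tsum_geometric]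
    simp
  have helim : Tendsto e atTop (𝓝 0) := ENNReal.tendsto_atTop_zero_of_tsum_ne_top hsum
  choose g hg hgu hgs using fun j => h (e j) (he j)
  let N : ℕ → ℝ := fun j => 2 ^ j
  have hN : ∀ j, 0 < N j := fun j => by positivity
  have hNe : ∀ j, ENNReal.ofReal (1 / N j) = e j := fun j => by
    simp only [N, e, one_div]
    rw [ENNReal.ofReal_inv_of_pos (by positivity), ENNReal.ofReal_pow (by simp), ENNReal.inv_pow]
    simp
  let g' : ℕ → X → ℝ := fun j => Ω.piecewise (g j) 0
  have hg' : ∀ j, Measurable (g' j) := fun j =>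
    ((hg j).continuousOn hΩ).measurable_piecewise continuousOn_const hΩ.measurableSet
  have hgg : ∀ j, ∀ x ∈ Ω, g' j x = g j x := fun j x hx => piecewise_eq_of_mem _ _ _ hx
  let F : ℕ → ℝ → ℝ≥0∞ := fun j t => ∫⁻ x in Ω,
    (Icc (g' j x) (g' j x + 1 / N j)).indicator (fun _ => ENNReal.ofReal (N j)) t *
      Ω.indicator (mSlope (g j)) x ∂m
  let G : ℕ → ℝ → ℝ≥0∞ := fun j t => ∫⁻ x in Ω,
    ENNReal.ofReal |ramp (N j) t (g' j x) - {x | u x < t}.indicator (fun _ => 1) x| ∂m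
  have hF := fun j => lintegral_ramp_slope (m := m.restrict Ω) (hN j) (hg' j)
    (measurable_indicator_mSlope hΩ ((hg j).continuousOn hΩ))
  have hG := fun j => lintegral_abs_ramp_comp_sub_le (m := m.restrict Ω) (hN j) (hg' j) hu
  have hFe : ∀ j, ∫⁻ t, F j t ≤ c + e j := fun j => by
    refine (hF j).2.trans_le (le_trans (le_of_eq ?_) (hgs j))
    exact setLIntegral_congr_fun hΩ.measurableSet fun x hx => indicator_of_mem hx _
  have hGe : ∀ j, ∫⁻ t, G j t ≤ e j * (1 + m Ω) := fun j => by
    refine (hG j).2.trans ?_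
    rw [hNe, Measure.restrict_apply_univ, mul_add, mul_one]
    gcongr
    refine le_trans (le_of_eq ?_) (hgu j)
    exact setLIntegral_congr_fun hΩ.measurableSet fun x hx => by simp only [hgg j x hx]
  have hGae : ∀ᵐ t, Tendsto (fun j => G j t) atTop (𝓝 0) := by
    have : ∫⁻ t, ∑' j, G j t ≠ ∞ := by
      rw [lintegral_tsum fun j => (hG j).1.aemeasurable]
      refine ne_top_of_le_ne_top ?_ (ENNReal.tsum_le_tsum hGe)
      rw [ENNReal.tsum_mul_right]
      exact ENNReal.mul_ne_top hsum (ENNReal.add_ne_top.2 ⟨ENNReal.one_ne_top, measure_ne_top _ _⟩)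
    filter_upwards [ae_lt_top (Measurable.tsum fun j => (hG j).1) this] with t ht
    exact ENNReal.tendsto_atTop_zero_of_tsum_ne_top ht.ne
  calc ∫⁻ t, Per m {x | u x < t} Ω ≤ ∫⁻ t, liminf (fun j => F j t) atTop := by
        refine lintegral_mono_ae ?_
        filter_upwards [hGae] with t ht
        refine (totVar_le_liminf hΩ Subset.rfl (fn := fun j x => ramp (N j) t (g j x))
          (fun j => (hg j).comp hΩ (lipschitzWith_ramp _ _)) fun K hK _ => ?_).trans
          (liminf_le_liminf (Eventually.of_forall fun j => ?_))
        · refine tendsto_of_tendsto_of_tendsto_of_le_of_le tendsto_const_nhds ht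
            (fun _ => bot_le) fun j => (lintegral_mono_set hK).trans (le_of_eq ?_)
          exact setLIntegral_congr_fun hΩ.measurableSet fun x hx => by simp only [hgg j x hx]
        · refine setLIntegral_mono' hΩ.measurableSet fun x hx => ?_
          rw [hgg j x hx, indicator_of_mem hx]
          exact mSlope_ramp_le (hN j) t (((hg j).continuousOn hΩ).continuousAt (hΩ.mem_nhds hx))
    _ ≤ liminf (fun j => ∫⁻ t, F j t) atTop := lintegral_liminf_le fun j => (hF j).1
    _ ≤ liminf (fun j => c + e j) atTop := liminf_le_liminf (Eventually.of_forall hFe)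
    _ = c := by simpa using (tendsto_const_nhds.add helim).liminf_eq

end Coarea

section CoareaOpen

lemma abs_indicator_one_le {X : Type*} (E : Set X) (x : X) :
    |E.indicator (fun _ => (1 : ℝ)) x| ≤ 1 := by
  by_cases h : x ∈ E <;> simp [h]

lemma lintegral_abs_indicator_sublevel_sub {X : Type*} [MeasurableSpace X] (m : Measure X)
    {u : X → ℝ} (hu : Measurable u) {s t : ℝ} (hst : s ≤ t) (Ω : Set X) :
    ∫⁻ x in Ω, ENNReal.ofReal |{x | u x < s}.indicator (fun _ => (1 : ℝ)) x -
      {x | u x < t}.indicator (fun _ => 1) x| ∂m ≤ m {x | s ≤ u x ∧ u x < t} := by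
  have hm : MeasurableSet {x | s ≤ u x ∧ u x < t} :=
    (measurableSet_le measurable_const hu).inter (measurableSet_lt hu measurable_const)
  refine (setLIntegral_le_lintegral _ _).trans ?_
  rw [← lintegral_indicator_one hm]
  refine lintegral_mono fun x => ?_
  simp only [indicator_apply, mem_ofPred_eq, Pi.one_apply]
  by_cases h1 : u x < s
  · simp [h1, h1.trans_le hst]
  · by_cases h2 : u x < t <;> simp [h1, h2, not_lt.1 h1]

variable [MetricSpace X] [MeasurableSpace X] [BorelSpace X] {m : Measure X}

variable [CompleteSpace X] [TopologicalSpace.SeparableSpace X] [IsFiniteMeasure m]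

lemma measurable_per_sublevel {Ω : Set X} (hΩ : IsOpen Ω) {u : X → ℝ} (hu : Measurable u) :
    Measurable fun t => Per m {x | u x < t} Ω := by
  refine measurable_of_Ioi fun c => ?_
  have key : MeasurableSet {t | c < Per m {x | u x < -t} Ω} := by
    refine MeasurableSet.of_mem_nhdsGT fun t (ht : c < _) => ?_
    by_contra hcon
    refine not_le.2 ht (Appr.totVar_le hΩ (Appr.of_close fun ε hε => ?_))
    obtain ⟨n, hn⟩ : ∃ n : ℕ, m {x | -t - 1 / ((n : ℝ) + 1) ≤ u x ∧ u x < -t} ≤ ε := by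
      have := tendsto_measure_iInter_atTop (μ := m)
        (s := fun n : ℕ => {x | -t - 1 / ((n : ℝ) + 1) ≤ u x ∧ u x < -t})
        (fun n => ((measurableSet_le measurable_const hu).inter
          (measurableSet_lt hu measurable_const)).nullMeasurableSet)
        (fun i j hij x hx => ⟨le_trans (by gcongr) hx.1, hx.2⟩) ⟨0, measure_ne_top _ _⟩
      have e : (⋂ n : ℕ, {x | -t - 1 / ((n : ℝ) + 1) ≤ u x ∧ u x < -t}) = ∅ := by
        refine eq_empty_of_forall_notMem fun x hx => ?_
        rw [mem_iInter] at hx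
        obtain ⟨n, hn⟩ := exists_nat_one_div_lt (sub_pos.2 (hx 0).2)
        linarith [(hx n).1]
      rw [e, measure_empty] at this
      obtain ⟨n, hn⟩ := (this.eventually_lt_const (pos_iff_ne_zero.2 hε)).exists
      exact ⟨n, hn.le⟩
    obtain ⟨s, hs1, hs2, hs3⟩ : ∃ s, Per m {x | u x < -s} Ω ≤ c ∧ t < s ∧
        s < t + 1 / ((n : ℝ) + 1) := by
      have h1 : ∃ᶠ s in 𝓝[>] t, Per m {x | u x < -s} Ω ≤ c := by
        refine fun h => hcon ?_
        filter_upwards [h] with s hs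
        exact not_le.1 hs
      obtain ⟨s, h, h'⟩ := (h1.and_eventually (Ioo_mem_nhdsGT
        (show t < t + 1 / ((n : ℝ) + 1) by linarith [Nat.one_div_pos_of_nat (α := ℝ) (n := n)]))).exists
      exact ⟨s, h, h'⟩
    have hms : ∀ s, Measurable ({x | u x < s}.indicator fun _ => (1 : ℝ)) := fun s =>
      measurable_const.indicator (measurableSet_lt hu measurable_const)
    refine ⟨{x | u x < -s}.indicator fun _ => 1, (continuous_abs.measurable.comp
      ((hms _).sub (hms _))).aemeasurable, ?_, ?_⟩
    · exact (appr_of_totVar_le hΩ (measure_ne_top _ _) (fun x _ => abs_indicator_one_le _ x)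
        ht.ne_top hs1).mono le_self_add
    · refine (lintegral_abs_indicator_sublevel_sub m hu (by linarith) Ω).trans
        ((measure_mono fun x hx => ?_).trans hn)
      exact ⟨by linarith [hx.1], hx.2⟩
  have := measurable_neg key
  simpa [preimage, mem_ofPred_eq] using this

lemma abs_sum_step_sub_le {δ : ℝ} (hδ : 0 ≤ δ) {t : ℕ → ℝ} {a : ℝ} (n : ℕ)
    (ht : ∀ i < n, t i ∈ Ioo (i * δ) ((i + 1) * δ)) (ha : 0 ≤ a) (han : a ≤ n * δ) :
    |∑ i ∈ Finset.range n, δ * (if a < t i then 1 else 0) - (n * δ - a)| ≤ δ := by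
  suffices h : (n * δ ≤ a → ∑ i ∈ Finset.range n, δ * (if a < t i then (1 : ℝ) else 0) = 0) ∧
      (a < n * δ → |∑ i ∈ Finset.range n, δ * (if a < t i then 1 else 0) - (n * δ - a)| ≤ δ) by
    rcases han.lt_or_eq with h' | h'
    · exact h.2 h'
    · rw [h.1 h'.ge, ← h']
      simpa using hδ
  clear han
  induction n with
  | zero => exact ⟨fun _ => by simp, fun h => by simp at h; linarith⟩
  | succ n ih =>
    obtain ⟨ih1, ih2⟩ := ih fun i hi => ht i (by omega)
    obtain ⟨h1, h2⟩ := ht n (by omega)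
    push_cast
    rw [Finset.sum_range_succ]
    refine ⟨fun h => ?_, fun h => ?_⟩
    · rw [ih1 (by linarith), if_neg (by linarith)]
      simp
    · rcases lt_or_ge a (n * δ) with h' | h'
      · rw [if_pos (by linarith)]
        convert ih2 h' using 2
        ring
      · rw [ih1 h', abs_le]
        split_ifs <;> constructor <;> linarith

lemma appr_of_lintegral_per_sublevel {Ω : Set X} (hΩ : IsOpen Ω) {u : X → ℝ}
    (hu : Measurable u) {R : ℝ} (hR : 0 < R) (h0 : ∀ x, 0 ≤ u x) (hu1 : ∀ x, u x ≤ R)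
    (hfin : ∫⁻ t in Ioo 0 R, Per m {x | u x < t} Ω ≠ ∞) :
    Appr m u Ω (∫⁻ t in Ioo 0 R, Per m {x | u x < t} Ω) := by
  refine Appr.of_close fun ε hε => ?_
  obtain ⟨n, hn0, hn⟩ : ∃ n : ℕ, 0 < n ∧ ENNReal.ofReal (R / n) * m univ ≤ ε := by
    have h1 : Tendsto (fun n : ℕ => ENNReal.ofReal (R / n) * m univ) atTop
        (𝓝 (ENNReal.ofReal 0 * m univ)) :=
      ENNReal.Tendsto.mul_const (ENNReal.tendsto_ofReal (tendsto_const_div_atTop_nhds_zero_nat R))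
        (Or.inr (measure_ne_top _ _))
    rw [ENNReal.ofReal_zero, zero_mul] at h1
    obtain ⟨n, h, h'⟩ := ((eventually_gt_atTop 0).and
      (h1.eventually_lt_const (pos_iff_ne_zero.2 hε))).exists
    exact ⟨n, h, h'.le⟩
  set δ : ℝ := R / n with hδ
  have hn' : (0 : ℝ) < n := by exact_mod_cast hn0
  have hδ0 : 0 < δ := by positivity
  have hnδ : n * δ = R := by rw [hδ]; field_simp
  have hvol : ∀ i : ℕ, volume (Ioo (i * δ) ((i + 1) * δ)) = ENNReal.ofReal δ := fun i => by
    rw [Real.volume_Ioo]; congr 1; ring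
  have hPm := measurable_per_sublevel (m := m) hΩ hu
  have hex : ∀ i : ℕ, ∃ t ∈ Ioo (i * δ) ((i + 1) * δ), ENNReal.ofReal δ * Per m {x | u x < t} Ω ≤
      ∫⁻ t in Ioo (i * δ) ((i + 1) * δ), Per m {x | u x < t} Ω := fun i => by
    obtain ⟨t, ht, hle⟩ := exists_le_setLAverage (μ := volume) (s := Ioo (i * δ) ((i + 1) * δ))
      (by simp [hvol, hδ0]) (by simp [hvol]) hPm.aemeasurable
    refine ⟨t, ht, ?_⟩
    rw [setLAverage_eq, hvol] at hle
    rw [mul_comm]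
    exact ENNReal.mul_le_of_le_div hle
  choose t ht hPt using hex
  have hsum : ∑ i ∈ Finset.range n, ∫⁻ t in Ioo (i * δ) ((i + 1) * δ), Per m {x | u x < t} Ω ≤
      ∫⁻ t in Ioo 0 R, Per m {x | u x < t} Ω := by
    rw [← lintegral_biUnion_finset (fun i _ j _ hij => ?_) fun i _ => measurableSet_Ioo]
    · refine lintegral_mono_set (iUnion₂_subset fun i hi s hs => ⟨?_, ?_⟩)
      · exact lt_of_le_of_lt (by positivity) hs.1
      · refine hs.2.trans_le ?_
        rw [← hnδ]
        gcongr
        exact_mod_cast Finset.mem_range.1 hi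
    · have key : ∀ i j : ℕ, i < j → Disjoint (Ioo (i * δ) ((i + 1) * δ)) (Ioo (j * δ) ((j + 1) * δ)) :=
        fun i j hij => disjoint_left.2 fun s hs hs' => by
          have : (i + 1 : ℝ) * δ ≤ j * δ := by
            gcongr
            exact_mod_cast hij
          linarith [hs.2, hs'.1]
      rcases lt_or_gt_of_ne hij with h | h
      · exact key _ _ h
      · exact (key _ _ h).symm
  have hms : ∀ s, Measurable ({x | u x < s}.indicator fun _ => (1 : ℝ)) := fun s =>
    measurable_const.indicator (measurableSet_lt hu measurable_const)
  have hmS : Measurable fun x => R + (-1) * ∑ i ∈ Finset.range n,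
      δ * {x | u x < t i}.indicator (fun _ => (1 : ℝ)) x :=
    ((Finset.measurable_fun_sum _ fun i _ => (hms (t i)).const_mul δ).const_mul _).const_add R
  refine ⟨fun x => R + (-1) * ∑ i ∈ Finset.range n,
      δ * {x | u x < t i}.indicator (fun _ => (1 : ℝ)) x,
    (continuous_abs.measurable.comp (hmS.sub hu)).aemeasurable, ?_, ?_⟩
  · have hA : ∀ i ∈ Finset.range n, Appr m ({x | u x < t i}.indicator fun _ => (1 : ℝ)) Ω
        (Per m {x | u x < t i} Ω) := fun i hi => by
      refine appr_of_totVar_le hΩ (measure_ne_top _ _) (fun x _ => abs_indicator_one_le _ x)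
        ?_ le_rfl
      have h1 : ENNReal.ofReal δ * Per m {x | u x < t i} Ω ≠ ∞ := ne_top_of_le_ne_top hfin
        ((hPt i).trans ((Finset.single_le_sum_of_canonicallyOrdered hi (f := fun i : ℕ =>
          ∫⁻ t in Ioo (i * δ) ((i + 1) * δ), Per m {x | u x < t} Ω)).trans hsum))
      intro htop
      rw [htop, ENNReal.mul_top (by simpa using hδ0)] at h1
      exact h1 rfl
    refine ((appr_const R Ω).add hΩ measurable_const (Appr.const_mul hΩ (-1)
      (Appr.sum (Finset.range n) hΩ (fun i => (hms (t i)).const_mul δ)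
        fun i hi => (hA i hi).const_mul hΩ δ))).mono ?_
    rw [zero_add, abs_neg, abs_one, ENNReal.ofReal_one, one_mul, abs_of_pos hδ0]
    exact (Finset.sum_le_sum fun i _ => hPt i).trans (hsum.trans le_self_add)
  · calc ∫⁻ x in Ω, ENNReal.ofReal |R + (-1) * ∑ i ∈ Finset.range n,
          δ * {x | u x < t i}.indicator (fun _ => (1 : ℝ)) x - u x| ∂m
        ≤ ∫⁻ x in Ω, ENNReal.ofReal δ ∂m := by
          refine lintegral_mono fun x => ENNReal.ofReal_le_ofReal ?_
          have := abs_sum_step_sub_le hδ0.le (t := t) n (fun i _ => ht i) (h0 x) (by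
            rw [hnδ]; exact hu1 x)
          rw [hnδ, abs_sub_comm] at this
          refine le_trans (le_of_eq ?_) this
          simp only [indicator_apply, mem_ofPred_eq]
          congr 1
          ring
      _ ≤ ENNReal.ofReal δ * m univ := by
          rw [setLIntegral_const]
          gcongr
          exact subset_univ _
      _ ≤ ε := hn

lemma totVar_eq_lintegral_per_sublevel_of_isOpen {Ω : Set X} (hΩ : IsOpen Ω) {u : X → ℝ}
    (hu : Measurable u) {R : ℝ} (hR : 0 < R) (h0 : ∀ x, 0 ≤ u x) (hu1 : ∀ x, u x ≤ R) :
    totVar m u Ω = ∫⁻ t in Ioo 0 R, Per m {x | u x < t} Ω := by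
  refine le_antisymm ?_ ?_
  · by_cases hfin : ∫⁻ t in Ioo 0 R, Per m {x | u x < t} Ω = ∞
    · simp [hfin]
    · exact (appr_of_lintegral_per_sublevel hΩ hu hR h0 hu1 hfin).totVar_le hΩ
  · by_cases hfin : totVar m u Ω = ∞
    · simp [hfin]
    · refine (setLIntegral_le_lintegral _ _).trans (lintegral_per_sublevel_le hΩ hu ?_)
      exact appr_of_totVar_le hΩ (measure_ne_top _ _) (M := R)
        (fun x _ => abs_le.2 ⟨by linarith [h0 x], hu1 x⟩) hfin le_rfl

/-- The coarea formula for bounded functions of bounded variation and finite measures. -/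
lemma totVar_eq_lintegral_per_sublevel {u : X → ℝ}
    (hu : Measurable u) {R : ℝ} (hR : 0 < R) (h0 : ∀ x, 0 ≤ u x) (hu1 : ∀ x, u x ≤ R)
    (hfin : totVar m u univ ≠ ∞) {B : Set X} (hB : MeasurableSet B) :
    AEMeasurable (fun t => Per m {x | u x < t} B) (volume.restrict (Ioo 0 R)) ∧
      totVar m u B = ∫⁻ t in Ioo 0 R, Per m {x | u x < t} B := by
  classical
  obtain ⟨μ, hμ⟩ := exists_measure_eq_totVar (m := m) hu (M := R)
    fun x => abs_le.2 ⟨by linarith [h0 x], hu1 x⟩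
  have hE : ∀ t, MeasurableSet {x | u x < t} := fun t => measurableSet_lt hu measurable_const
  choose D hD using fun t => exists_measure_eq_totVar (m := m)
    (measurable_const.indicator (hE t)) (abs_indicator_one_le {x | u x < t})
  have hDP : ∀ t A, MeasurableSet A → D t A = Per m {x | u x < t} A := fun t A hA => hD t A hA
  let κ : ℝ → Measure X := fun t => if D t univ < ∞ then D t else 0
  have hκfin : ∀ t, IsFiniteMeasure (κ t) := fun t => by
    by_cases h : D t univ < ∞
    · simp only [κ, if_pos h]
      exact ⟨h⟩
    · simp only [κ, if_neg h]
      infer_instance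
  have hDm : ∀ Ω, IsOpen Ω → Measurable fun t => D t Ω := fun Ω hΩ => by
    simp only [hDP _ Ω hΩ.measurableSet]
    exact measurable_per_sublevel hΩ hu
  have hκop : ∀ Ω, IsOpen Ω → Measurable fun t => κ t Ω := fun Ω hΩ => by
    have : (fun t => κ t Ω) = fun t => if D t univ < ∞ then D t Ω else 0 := by
      funext t
      simp only [κ]
      split_ifs <;> rfl
    rw [this]
    exact Measurable.ite (measurableSet_lt (hDm _ isOpen_univ) measurable_const) (hDm Ω hΩ)
      measurable_const
  have hgen : ‹MeasurableSpace X› = MeasurableSpace.generateFrom {s | IsOpen s} :=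
    BorelSpace.measurable_eq
  have hκ : Measurable κ := Measurable.measure_of_isPiSystem hgen isPiSystem_isOpen
    (fun s hs => hκop s hs) (hκop _ isOpen_univ)
  have hopen := fun (Ω : Set X) (hΩ : IsOpen Ω) =>
    totVar_eq_lintegral_per_sublevel_of_isOpen (m := m) hΩ hu hR h0 hu1
  have hae : ∀ᵐ t ∂volume.restrict (Ioo 0 R), κ t = D t := by
    have h1 : ∫⁻ t in Ioo 0 R, D t univ ≠ ∞ := by
      simp only [hDP _ _ MeasurableSet.univ]
      rwa [← hopen _ isOpen_univ]
    filter_upwards [ae_lt_top (hDm _ isOpen_univ) h1] with t ht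
    exact if_pos ht
  have hκB : ∀ A, MeasurableSet A →
      (fun t => κ t A) =ᵐ[volume.restrict (Ioo 0 R)] fun t => Per m {x | u x < t} A := fun A hA => by
    filter_upwards [hae] with t ht
    rw [ht, hDP t A hA]
  have hbind : ∀ A, MeasurableSet A → (volume.restrict (Ioo 0 R)).bind κ A =
      ∫⁻ t in Ioo 0 R, Per m {x | u x < t} A := fun A hA => by
    rw [Measure.bind_apply hA hκ.aemeasurable]
    exact lintegral_congr_ae (hκB A hA)
  have : IsFiniteMeasure μ := ⟨by rw [hμ _ MeasurableSet.univ]; exact hfin.lt_top⟩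
  have hopen' : ∀ Ω, IsOpen Ω → μ Ω = (volume.restrict (Ioo 0 R)).bind κ Ω := fun Ω hΩ => by
    rw [hμ Ω hΩ.measurableSet, hbind Ω hΩ.measurableSet, hopen Ω hΩ]
  have heq : μ = (volume.restrict (Ioo 0 R)).bind κ :=
    ext_of_generate_finite _ hgen isPiSystem_isOpen hopen' (hopen' _ isOpen_univ)
  exact ⟨⟨fun t => κ t B, (Measure.measurable_coe hB).comp hκ, (hκB B hB).symm⟩,
    by rw [← hμ B hB, heq, hbind B hB]⟩

end CoareaOpen

section Balls

variable [MetricSpace X] [MeasurableSpace X] [BorelSpace X] {m m' : Measure X}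

lemma totVar_le_of_restrict_eq {W B : Set X} (hW : IsOpen W) (hB : B ⊆ W) {f g : X → ℝ}
    (hm : m.restrict W = m'.restrict W) (hfg : EqOn f g W) : totVar m f B ≤ totVar m' g B := by
  have hr : ∀ {K : Set X}, K ⊆ W → m.restrict K = m'.restrict K := fun {K} hK => by
    rw [← Measure.restrict_restrict_of_subset hK, hm, Measure.restrict_restrict_of_subset hK]
  refine le_of_forall_gt fun c hc => ?_
  obtain ⟨Ω, hΩ, hBΩ, fn, hfn, hlim, hlt⟩ := exists_seq_of_totVar_lt hc
  have hlim' : TendstoL1loc m (Ω ∩ W) fn f := fun K hK hKc => by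
    refine (hlim K (hK.trans inter_subset_left) hKc).congr fun n => ?_
    rw [hr (hK.trans inter_subset_right)]
    refine setLIntegral_congr_fun hKc.measurableSet fun y hy => ?_
    rw [hfg (hK hy).2]
  refine (totVar_le_liminf (hΩ.inter hW) (subset_inter hBΩ hB)
    (fun n => (hfn n).mono inter_subset_left) hlim').trans_lt (lt_of_le_of_lt ?_ hlt)
  refine liminf_le_liminf (Eventually.of_forall fun n => ?_)
  rw [hr inter_subset_right]
  exact lintegral_mono_set inter_subset_left

lemma totVar_eq_of_restrict_eq {W B : Set X} (hW : IsOpen W) (hB : B ⊆ W) {f g : X → ℝ}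
    (hm : m.restrict W = m'.restrict W) (hfg : EqOn f g W) : totVar m f B = totVar m' g B :=
  (totVar_le_of_restrict_eq hW hB hm hfg).antisymm
    (totVar_le_of_restrict_eq hW hB hm.symm hfg.symm)

variable [CompleteSpace X] [TopologicalSpace.SeparableSpace X]

lemma per_ball_inter_ball {x : X} {s r : ℝ} (hsr : s < r) (hr : m (ball x r) ≠ ∞) (E : Set X) :
    Per m (ball x s) (E ∩ ball x r) = Per m (ball x s) E := by
  refine le_antisymm (totVar_mono _ _ inter_subset_left) (le_of_forall_gt fun c hc => ?_)
  obtain ⟨Ω, hΩ, hE, hlt⟩ := exists_open_totVar_lt hc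
  obtain ⟨a, hsa, har⟩ := exists_between hsr
  obtain ⟨b, hab, hbr⟩ := exists_between har
  obtain ⟨τ, C, hτ, hτ0, hτ1, hτa, hτb⟩ := exists_lipschitz_cutoff (LipschitzWith.dist_left x) hab
  have hd : Continuous fun y => dist y x := continuous_id.dist continuous_const
  have hU₁ : IsOpen (Ω ∩ ball x r) := hΩ.inter isOpen_ball
  have hU₂ : IsOpen {y | s < dist y x} := isOpen_lt continuous_const hd
  have hU₃ : IsOpen {y | b < dist y x} := isOpen_lt continuous_const hd
  have hmono := totVar_mono m ((ball x s).indicator fun _ => (1 : ℝ)) (A := Ω ∩ ball x r)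
    inter_subset_left
  have h₁ : Appr m ((ball x s).indicator fun _ => (1 : ℝ)) (Ω ∩ ball x r)
      (totVar m ((ball x s).indicator fun _ => (1 : ℝ)) Ω) :=
    appr_of_totVar_le hU₁ (measure_ne_top_of_subset inter_subset_right hr)
      (fun y _ => abs_indicator_one_le _ y) hlt.ne_top hmono
  have h₂ : Appr m ((ball x s).indicator fun _ => (1 : ℝ)) {y | s < dist y x} 0 :=
    (appr_const 0 _).congr_on hU₂ fun y (hy : s < dist y x) => by
      simp [mem_ball, hy.le]
  have hglue : Appr m ((ball x s).indicator fun _ => (1 : ℝ))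
      (Ω ∩ ball x r ∪ {y | b < dist y x})
      (∑' i : Bool, bif i then totVar m ((ball x s).indicator fun _ => (1 : ℝ)) Ω else 0) := by
    refine Appr.glue (hU₁.union hU₃)
      (U := fun i => bif i then Ω ∩ ball x r else {y | s < dist y x})
      (φ := fun i y => bif i then 1 - τ y else τ y) (C := fun i => bif i then 0 + C else C)
      ?_ ?_ ?_ ?_ ?_ ?_ (measurable_const.indicator measurableSet_ball) ?_
    · rintro (_ | _)
      exacts [hU₂, hU₁]
    · rintro (_ | _)
      exacts [hτ, (LipschitzWith.const 1).sub hτ]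
    · rintro (_ | _) y
      exacts [hτ0 y, sub_nonneg.2 (hτ1 y)]
    · rintro (_ | _) y
      exacts [hτ1 y, sub_le_self _ (hτ0 y)]
    · rintro y hy (_ | _) hyU
      · have hya : dist y x < a := (not_lt.1 hyU).trans_lt hsa
        filter_upwards [hd.continuousAt.eventually_lt_const hya] with z hz using hτa z hz.le
      · have hyb : y ∈ {y | b < dist y x} := hy.resolve_left hyU
        filter_upwards [hU₃.mem_nhds hyb] with z hz
        simp [hτb z (le_of_lt hz)]
    · exact fun y _ => ⟨Finset.univ, Eventually.of_forall fun z => ⟨by simp, by simp⟩⟩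
    · rintro (_ | _)
      exacts [h₂, h₁]
  refine (totVar_mono m _ fun y hy => ?_).trans_lt
    ((Appr.totVar_le (hU₁.union hU₃) hglue).trans_lt (by simpa [tsum_bool] using hlt))
  rcases lt_or_ge b (dist y x) with h | h
  · exact Or.inr h
  · have hyr : y ∈ ball x r := mem_ball.2 (h.trans_lt hbr)
    exact Or.inl ⟨hE ⟨hy, hyr⟩, hyr⟩

lemma totVar_dist_inter_ball {x : X} {r : ℝ} (h0 : 0 < r) (hr : m (ball x r) ≠ ∞) {E : Set X}
    (hE : MeasurableSet E) :
    AEMeasurable (fun s => Per m (ball x s) E) (volume.restrict (Ioo 0 r)) ∧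
      totVar m (fun y => dist y x) (E ∩ ball x r) = ∫⁻ s in Ioo 0 r, Per m (ball x s) E ∧
      totVar m (fun y => dist y x) (E ∩ ball x r) ≠ ∞ := by
  have : IsFiniteMeasure (m.restrict (ball x r)) := ⟨by simpa using hr.lt_top⟩
  have hu : LipschitzWith 1 fun y => min (dist y x) r :=
    (LipschitzWith.dist_left x).min_const r
  have hfin : totVar (m.restrict (ball x r)) (fun y => min (dist y x) r) univ ≠ ∞ := by
    have hL : LocLipOn univ fun y => min (dist y x) r := fun y _ =>
      ⟨1, one_pos, 1, hu.lipschitzOnWith⟩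
    refine ((hL.appr.totVar_le isOpen_univ).trans_lt ?_).ne
    refine (lintegral_mono fun y => mSlope_le_of_lipschitz hu y).trans_lt ?_
    simpa using hr.lt_top
  have hrr : m.restrict (ball x r) = (m.restrict (ball x r)).restrict (ball x r) := by
    rw [Measure.restrict_restrict_of_subset Subset.rfl]
  have hV : totVar m (fun y => dist y x) (E ∩ ball x r) =
      totVar (m.restrict (ball x r)) (fun y => min (dist y x) r) (E ∩ ball x r) :=
    totVar_eq_of_restrict_eq isOpen_ball inter_subset_right hrr fun y hy =>
      (min_eq_left (mem_ball.1 hy).le).symm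
  have hP : ∀ s ∈ Ioo 0 r, Per (m.restrict (ball x r)) {y | min (dist y x) r < s} (E ∩ ball x r) =
      Per m (ball x s) E := fun s hs => by
    have : {y | min (dist y x) r < s} = ball x s := by
      ext y
      simp [mem_ball, hs.2.le, mem_ofPred_eq]
    rw [this, ← per_ball_inter_ball hs.2 hr]
    exact totVar_eq_of_restrict_eq isOpen_ball inter_subset_right hrr.symm fun _ _ => rfl
  obtain ⟨h1, h2⟩ := totVar_eq_lintegral_per_sublevel hu.continuous.measurable h0
    (fun y => le_min dist_nonneg h0.le) (fun y => min_le_right _ _) hfin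
    (hE.inter (measurableSet_ball (x := x) (ε := r)))
  refine ⟨h1.congr ?_, ?_, ?_⟩
  · filter_upwards [ae_restrict_mem measurableSet_Ioo] with s hs using hP s hs
  · rw [hV, h2]
    exact setLIntegral_congr_fun measurableSet_Ioo hP
  · rw [hV]
    exact ((totVar_mono _ _ (subset_univ _)).trans_lt hfin.lt_top).ne

end Balls

section Primitive

lemma toReal_setLIntegral_Ioo_sub {p : ℝ → ℝ≥0∞} {s t : ℝ} (hs : 0 < s) (hst : s ≤ t)
    (hfin : ∫⁻ u in Ioo 0 t, p u ≠ ∞) :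
    (∫⁻ u in Ioo 0 t, p u).toReal - (∫⁻ u in Ioo 0 s, p u).toReal =
      (∫⁻ u in Ioo s t, p u).toReal := by
  have h : ∫⁻ u in Ioo 0 t, p u = (∫⁻ u in Ioo 0 s, p u) + ∫⁻ u in Ioo s t, p u := by
    rw [setLIntegral_congr (Ioo_ae_eq_Ico (a := s) (b := t)),
      ← lintegral_union measurableSet_Ico (Set.disjoint_left.2 fun u hu hu' => not_lt.2 hu'.1 hu.2),
      Ioo_union_Ico_eq_Ioo hs hst]
  have h' := ENNReal.add_ne_top.1 (h ▸ hfin)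
  rw [h, ENNReal.toReal_add h'.1 h'.2]
  ring

lemma absContOnI_setLIntegral_Ioo {p : ℝ → ℝ≥0∞} {a b : ℝ} (ha : 0 < a)
    (hfin : ∫⁻ u in Ioo 0 b, p u ≠ ∞) :
    AbsContOnI (fun r => (∫⁻ u in Ioo 0 r, p u).toReal) a b := fun ε hε => by
  obtain ⟨δ, hδ, h⟩ := exists_pos_setLIntegral_lt_of_measure_lt hfin
    (ENNReal.ofReal_pos.2 hε).ne'
  have hδ1 : min δ 1 ≠ ∞ := (min_le_right _ _).trans_lt one_lt_top |>.ne
  refine ⟨(min δ 1).toReal, ENNReal.toReal_pos (lt_min hδ one_pos).ne' hδ1,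
    fun n s t hst hdis hsum => ?_⟩
  have hfin' : ∀ r ≤ b, ∫⁻ u in Ioo 0 r, p u ≠ ∞ := fun r hr =>
    ne_top_of_le_ne_top hfin (lintegral_mono_set (Ioo_subset_Ioo_right hr))
  have hsub : ∀ i, Ioo (s i) (t i) ⊆ Ioo 0 b := fun i =>
    Ioo_subset_Ioo (ha.le.trans (hst i).1.1) (hst i).2.1.2
  have hU : MeasurableSet (⋃ i, Ioo (s i) (t i)) := MeasurableSet.iUnion fun _ => measurableSet_Ioo
  have hvol : volume.restrict (Ioo 0 b) (⋃ i, Ioo (s i) (t i)) < δ := by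
    refine (Measure.restrict_apply_le _ _).trans_lt ?_
    rw [measure_iUnion hdis fun _ => measurableSet_Ioo, tsum_fintype]
    simp only [Real.volume_Ioo]
    rw [← ENNReal.ofReal_sum_of_nonneg fun i _ => sub_nonneg.2 (hst i).2.2]
    exact ((ENNReal.ofReal_lt_iff_lt_toReal
      (Finset.sum_nonneg fun i _ => sub_nonneg.2 (hst i).2.2) hδ1).2 hsum).trans_le (min_le_left _ _)
  have key := h _ hvol
  rw [Measure.restrict_restrict hU, inter_eq_left.2 (iUnion_subset hsub),
    lintegral_iUnion (fun _ => measurableSet_Ioo) hdis, tsum_fintype] at key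
  have hne : ∀ i, ∫⁻ u in Ioo (s i) (t i), p u ≠ ∞ := fun i =>
    ne_top_of_le_ne_top hfin (lintegral_mono_set (hsub i))
  have : ∀ i, |(∫⁻ u in Ioo 0 (t i), p u).toReal - (∫⁻ u in Ioo 0 (s i), p u).toReal| =
      (∫⁻ u in Ioo (s i) (t i), p u).toReal := fun i => by
    rw [toReal_setLIntegral_Ioo_sub (ha.trans_le (hst i).1.1) (hst i).2.2 (hfin' _ (hst i).2.1.2),
      abs_of_nonneg ENNReal.toReal_nonneg]
  simp only [this]
  rw [← ENNReal.toReal_sum fun i _ => hne i]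
  exact (ENNReal.lt_ofReal_iff_toReal_lt key.ne_top).1 key

lemma ae_hasDerivAt_setLIntegral_Ioo {p : ℝ → ℝ≥0∞}
    (hp : ∀ r, 0 < r → AEMeasurable p (volume.restrict (Ioo 0 r)))
    (hfin : ∀ r, 0 < r → ∫⁻ u in Ioo 0 r, p u ≠ ∞) :
    ∀ᵐ r : ℝ, 0 < r → HasDerivAt (fun s => (∫⁻ u in Ioo 0 s, p u).toReal) (p r).toReal r := by
  have hint : ∀ r, 0 < r → IntegrableOn (fun u => (p u).toReal) (Ioo 0 r) := fun r hr =>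
    integrable_toReal_of_lintegral_ne_top (hp r hr) (hfin r hr)
  have key : ∀ n : ℕ, ∀ᵐ r : ℝ, r ∈ Ioo 0 ((n : ℝ) + 1) →
      HasDerivAt (fun s => (∫⁻ u in Ioo 0 s, p u).toReal) (p r).toReal r := fun n => by
    have hn : (0 : ℝ) < n + 1 := n.cast_add_one_pos
    have hI : LocallyIntegrable _ volume :=
      ((integrable_indicator_iff measurableSet_Ioo).2 (hint _ hn)).locallyIntegrable
    filter_upwards [LocallyIntegrable.ae_hasDerivAt_integral hI] with r hr hrn
    have h := hr 0
    rw [indicator_of_mem hrn] at h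
    refine h.congr_of_eventuallyEq ?_
    filter_upwards [isOpen_Ioo.mem_nhds hrn] with s hs
    rw [intervalIntegral.integral_of_le hs.1.le, integral_Ioc_eq_integral_Ioo,
      ← integral_toReal (hp s hs.1) (ae_lt_top' (hp s hs.1) (hfin s hs.1))]
    refine setIntegral_congr_fun measurableSet_Ioo fun u hu => ?_
    rw [indicator_of_mem (show u ∈ Ioo 0 ((n : ℝ) + 1) from ⟨hu.1, hu.2.trans hs.2⟩)]
  filter_upwards [ae_all_iff.2 key] with r hr h0
  obtain ⟨n, hn⟩ := exists_nat_gt r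
  exact hr n ⟨h0, hn.trans (lt_add_one _)⟩

end Primitive

/-- **Consequence of the coarea formula** (Corollary 2.3): for
`f(r) := |D d_x|(E ∩ B_r(x))` one has `f(r) = ∫_0^r P(B_s(x), E) ds`; consequently
`f` is locally absolutely continuous on `(0, ∞)` and `f'(r) = P(B_r(x), E)` for
a.e. `r > 0`. -/
theorem coarea_consequence
    {X : Type*} [MetricSpace X] [CompleteSpace X] [TopologicalSpace.SeparableSpace X]
    [MeasurableSpace X] [BorelSpace X] (m : Measure X) (hbf : BoundedlyFinite m)
    (x : X) (E : Set X) (hE : MeasurableSet E)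
    (f : ℝ → ℝ≥0∞)
    (hf : ∀ r : ℝ, f r = totVar m (fun z => dist z x) (E ∩ Metric.ball x r)) :
    (∀ r : ℝ, 0 < r → f r = ∫⁻ s in Set.Ioo (0:ℝ) r, Per m (Metric.ball x s) E) ∧
    (∀ a b : ℝ, 0 < a → a ≤ b → AbsContOnI (fun r => (f r).toReal) a b) ∧
    (∀ᵐ r : ℝ, 0 < r →
      HasDerivAt (fun s => (f s).toReal) ((Per m (Metric.ball x r) E).toReal) r) := by
  have hball : ∀ r, m (ball x r) ≠ ∞ := fun r => (hbf _ isBounded_ball).ne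
  have hV := fun r (hr : 0 < r) => totVar_dist_inter_ball hr (hball r) hE
  have hint : ∀ r, 0 < r → f r = ∫⁻ s in Ioo (0 : ℝ) r, Per m (ball x s) E := fun r hr => by
    rw [hf, (hV r hr).2.1]
  have hfin : ∀ r, 0 < r → ∫⁻ s in Ioo (0 : ℝ) r, Per m (ball x s) E ≠ ∞ := fun r hr => by
    rw [← (hV r hr).2.1]
    exact (hV r hr).2.2
  have hF : f = fun r => ∫⁻ s in Ioo (0 : ℝ) r, Per m (ball x s) E := by
    funext r
    rcases lt_or_ge 0 r with hr | hr
    · exact hint r hr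
    · rw [hf, ball_eq_empty.2 hr, inter_empty, totVar_empty, Ioo_eq_empty_of_le hr,
        Measure.restrict_empty, lintegral_zero_measure]
  refine ⟨hint, fun a b ha hab => ?_, ?_⟩
  · rw [hF]
    exact absContOnI_setLIntegral_Ioo ha (hfin b (ha.trans_le hab))
  · rw [hF]
    exact ae_hasDerivAt_setLIntegral_Ioo (fun r hr => (hV r hr).1) hfin

end
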